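/- arXiv:1806.08656 — 4 statements merged into one kernel-verified Lean document; each statement's English description precedes it below -/
import Mathlib

section
/- Let X ⊆ ℝ^n be a set with non-empty interior and let C ⊆ P_{n,2d}(X) be a closed convex cone. Suppose that for every N ∈ ℕ there exists a finite subset S of X with |S| ≥ N such that for every k-element subset T of S there is a polynomial f ∈ C with f(s) = 0 for all s ∈ T and f(s) > 0 for all s ∈ S \ T. Then C has no ((𝒮₊ᵏ)^m)-lift for any m ∈ ℕ; that is, sxdeg(C) > k. -/
open MvPolynomial

/-- The cone of `m`-tuples of `k × k` real positive semidefinite matrices, `(𝒮₊ᵏ)^m`. -/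
def PSDTuple (k m : ℕ) : Set (Fin m → Matrix (Fin k) (Fin k) ℝ) :=
  {A | ∀ i, (A i).PosSemidef}

/-- The cone `𝒮₊ᵏ` of `k × k` real positive semidefinite matrices. -/
def PSDCone (k : ℕ) : Set (Matrix (Fin k) (Fin k) ℝ) :=
  {A | A.PosSemidef}

/-- `S ⊆ V` has a `K`-lift if `S = π(K ∩ H)` for an affine subspace `H` and a linear map `π`. -/
def HasLift {W V : Type*} [AddCommGroup W] [Module ℝ W] [AddCommGroup V] [Module ℝ V]
    (K : Set W) (S : Set V) : Prop :=
  ∃ (H : AffineSubspace ℝ W) (p : W →ₗ[ℝ] V), S = p '' (K ∩ (H : Set W))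

/-- Semidefinite extension degree: the smallest `k` such that `S` has an `(𝒮₊ᵏ)^m`-lift
for some finite `m` (`⊤` if there is no such `k`). -/
noncomputable def sxdeg {V : Type*} [AddCommGroup V] [Module ℝ V] (S : Set V) : ℕ∞ :=
  sInf {c : ℕ∞ | ∃ k m : ℕ, c = (k : ℕ∞) ∧ HasLift (PSDTuple k m) S}

/-- Semidefinite extension complexity: the smallest `k` such that `S` has an `𝒮₊ᵏ`-lift. -/
noncomputable def sxc {V : Type*} [AddCommGroup V] [Module ℝ V] (S : Set V) : ℕ∞ :=
  sInf {c : ℕ∞ | ∃ k : ℕ, c = (k : ℕ∞) ∧ HasLift (PSDCone k) S}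

/-- Coefficient embedding of polynomials into the product space `(Fin n →₀ ℕ) → ℝ`;
used to express topological notions (closedness) for sets of polynomials. -/
noncomputable def coeffMap (n : ℕ) : MvPolynomial (Fin n) ℝ →ₗ[ℝ] ((Fin n →₀ ℕ) → ℝ) where
  toFun f := fun a => coeff a f
  map_add' := by intros; funext; simp
  map_smul' := by intros; funext; simp

/-- `Σ_{n,2d}`: sums of squares of polynomials, of degree at most `2d`, in `n` variables. -/
def SOSCone (n d : ℕ) : Set (MvPolynomial (Fin n) ℝ) :=
  {f | f.totalDegree ≤ 2 * d ∧
    ∃ (r : ℕ) (g : Fin r → MvPolynomial (Fin n) ℝ), f = ∑ i, g i ^ 2}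

/-- `P_{n,2d}(X)`: polynomials of degree at most `2d` that are nonnegative on `X`. -/
def PosCone (n d : ℕ) (X : Set (Fin n → ℝ)) : Set (MvPolynomial (Fin n) ℝ) :=
  {f | f.totalDegree ≤ 2 * d ∧ ∀ x ∈ X, 0 ≤ MvPolynomial.eval x f}

/-- The vector `v_{n,d}(x) = (x^α)_{|α| ≤ d}` of all monomials of degree at most `d`
evaluated at `x`, regarded inside the coordinate space `(Fin n →₀ ℕ) → ℝ`. -/
noncomputable def monVec (n d : ℕ) (x : Fin n → ℝ) : (Fin n →₀ ℕ) → ℝ :=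
  fun a => if (a.sum fun _ e => e) ≤ d then ∏ i, x i ^ a i else 0

/-- The convex conic hull: all finite nonnegative combinations of elements of `s`. -/
def coneHull {V : Type*} [AddCommGroup V] [Module ℝ V] (s : Set V) : Set V :=
  {y | ∃ (r : ℕ) (c : Fin r → ℝ) (v : Fin r → V),
    (∀ i, 0 ≤ c i) ∧ (∀ i, v i ∈ s) ∧ y = ∑ i, c i • v i}

open Module in
/-- If no subspace strictly larger than `B` lies in many of the subspaces `N s`, then one can
select members of the family whose intersections drop in dimension until they reach `B`. -/
theorem exists_finset_inf_eq_or_finrank_add_card_le {α F V : Type*} [Field F] [AddCommGroup V]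
    [Module F V] [FiniteDimensional F V] (N : α → Submodule F V) (B : Submodule F V)
    (S : Finset α) (hB : ∀ s ∈ S, B ≤ N s) (b M : ℕ)
    (hb : ∀ B' : Submodule F V, B < B' → ∀ R ⊆ S, (∀ s ∈ R, B' ≤ N s) → R.card ≤ b)
    (hcard : 2 ^ M * b + M < S.card) (j : ℕ) (hj : j ≤ M) :
    ∃ S' ⊆ S, S'.card = j ∧
      ∀ T ⊆ S', T.inf N = B ∨ finrank F ↥(T.inf N) + T.card ≤ finrank F V := by
  classical
  induction j with
  | zero =>
    refine ⟨∅, by simp, rfl, fun T hT => Or.inr ?_⟩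
    rw [Finset.subset_empty.1 hT, Finset.card_empty, add_zero]
    exact Submodule.finrank_le _
  | succ j ih =>
    obtain ⟨S', hS', hc, hT⟩ := ih (by omega)
    let bad : Finset α := (S'.powerset.filter (fun T => T.inf N ≠ B)).biUnion
      fun T => S.filter fun s => T.inf N ≤ N s
    have hBT : ∀ T ⊆ S', B ≤ T.inf N := fun T hTS =>
      Finset.le_inf fun t ht => hB t (hS' (hTS ht))
    have hbad : bad.card ≤ 2 ^ M * b := by
      refine (Finset.card_biUnion_le_card_mul _ _ b fun T hT' => ?_).trans ?_
      · rw [Finset.mem_filter, Finset.mem_powerset] at hT'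
        exact hb _ (lt_of_le_of_ne (hBT T hT'.1) hT'.2.symm) _ (Finset.filter_subset _ _)
          fun s hs => (Finset.mem_filter.1 hs).2
      · refine Nat.mul_le_mul_right _ ((Finset.card_filter_le _ _).trans ?_)
        rw [Finset.card_powerset]
        exact Nat.pow_le_pow_right (by norm_num) (by omega)
    obtain ⟨s, hs, hs'⟩ : ∃ s ∈ S, s ∉ bad ∪ S' := by
      apply Finset.exists_mem_notMem_of_card_lt_card
      have := Finset.card_union_le bad S'
      omega
    rw [Finset.mem_union, not_or] at hs'
    refine ⟨insert s S', Finset.insert_subset hs hS', by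
      rw [Finset.card_insert_of_notMem hs'.2, hc], fun T hTS => ?_⟩
    by_cases hsT : s ∈ T
    · have hT₀ : T.erase s ⊆ S' := by
        rwa [← Finset.subset_insert_iff]
      have hinf : T.inf N = N s ⊓ (T.erase s).inf N := by
        rw [← Finset.inf_insert, Finset.insert_erase hsT]
      have hcT := Finset.card_erase_add_one hsT
      by_cases hEq : (T.erase s).inf N = B
      · left
        rw [hinf, hEq]
        exact inf_eq_right.2 (hB s hs)
      · right
        have hlt : T.inf N < (T.erase s).inf N := by
          rw [hinf]
          refine inf_lt_right.2 fun hle => hs'.1 ?_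
          exact Finset.mem_biUnion.2 ⟨T.erase s, Finset.mem_filter.2
            ⟨Finset.mem_powerset.2 hT₀, hEq⟩, Finset.mem_filter.2 ⟨hs, hle⟩⟩
        have h1 := Submodule.finrank_lt_finrank_of_lt hlt
        have h2 := (hT _ hT₀).resolve_left hEq
        omega
    · exact hT T ((Finset.subset_insert_iff_of_notMem hsT).1 hTS)

open Module in
theorem exists_card_forall_inf_le_of_finrank_le (α F V : Type*) [Field F] [AddCommGroup V]
    [Module F V] [FiniteDimensional F V] (M r : ℕ) :
    ∃ n : ℕ, ∀ (S : Finset α) (N : α → Submodule F V) (B : Submodule F V), n ≤ S.card →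
      (∀ s ∈ S, B ≤ N s) → finrank F V ≤ finrank F B + r →
      ∃ S' ⊆ S, S'.card = M ∧
        ∀ T ⊆ S', T.card = finrank F V → ∀ s ∈ S', T.inf N ≤ N s := by
  classical
  induction r with
  | zero =>
    refine ⟨M, fun S N B hn hB hr => ?_⟩
    obtain ⟨S', hS', hc⟩ := Finset.exists_subset_card_eq hn
    have hBtop : B = ⊤ := Submodule.eq_top_of_finrank_eq
      (le_antisymm (Submodule.finrank_le B) hr)
    refine ⟨S', hS', hc, fun T _ _ s hs => ?_⟩
    exact (hBtop ▸ le_top : T.inf N ≤ B).trans (hB s (hS' hs))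
  | succ r ih =>
    obtain ⟨n, hn⟩ := ih
    refine ⟨2 ^ M * n + M + 1, fun S N B hS hB hr => ?_⟩
    by_cases hbig : ∃ B' : Submodule F V, B < B' ∧ ∃ R ⊆ S, (∀ s ∈ R, B' ≤ N s) ∧ n < R.card
    · obtain ⟨B', hlt, R, hRS, hR, hnR⟩ := hbig
      have := Submodule.finrank_lt_finrank_of_lt hlt
      obtain ⟨S', hS', h⟩ := hn R N B' hnR.le hR (by omega)
      exact ⟨S', hS'.trans hRS, h⟩
    · push Not at hbig
      obtain ⟨S', hS', hc, h⟩ :=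
        exists_finset_inf_eq_or_finrank_add_card_le N B S hB n M hbig (by omega) M le_rfl
      refine ⟨S', hS', hc, fun T hT hTc s hs => ?_⟩
      rcases h T hT with h | h
      · exact h.le.trans (hB s (hS' hs))
      · have : finrank F ↥(T.inf N) = 0 := by omega
        rw [Submodule.finrank_eq_zero.1 this]
        exact bot_le

open Module in
/-- Ramsey-type statement: finitely many sufficiently long families of subspaces have a common
long subfamily in which any `dim V` members have intersection contained in all the members. -/
theorem exists_card_forall_inf_le (α F V ι : Type*) [Field F] [AddCommGroup V]
    [Module F V] [FiniteDimensional F V] (I : Finset ι) (M : ℕ) :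
    ∃ n : ℕ, ∀ (S : Finset α) (N : ι → α → Submodule F V), n ≤ S.card →
      ∃ S' ⊆ S, S'.card = M ∧ ∀ i ∈ I,
        ∀ T ⊆ S', T.card = finrank F V → ∀ s ∈ S', T.inf (N i) ≤ N i s := by
  classical
  induction I using Finset.induction_on with
  | empty =>
    refine ⟨M, fun S N hn => ?_⟩
    obtain ⟨S', hS', hc⟩ := Finset.exists_subset_card_eq hn
    exact ⟨S', hS', hc, by simp⟩
  | insert i I _ ih =>
    obtain ⟨n, hn⟩ := ih
    obtain ⟨n', hn'⟩ := exists_card_forall_inf_le_of_finrank_le α F V n (finrank F V)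
    refine ⟨n', fun S N hS => ?_⟩
    obtain ⟨S₁, hS₁, hc₁, h₁⟩ := hn' S (N i) ⊥ hS (fun _ _ => bot_le) (by omega)
    obtain ⟨S₂, hS₂, hc₂, h₂⟩ := hn S₁ N hc₁.ge
    refine ⟨S₂, hS₂.trans hS₁, hc₂, fun l hl T hT hTc s hs => ?_⟩
    rcases Finset.mem_insert.1 hl with rfl | hl
    · exact h₁ T (hT.trans hS₂) hTc s (hS₂ hs)
    · exact h₂ l hl T hT hTc s hs

/-- The part of the cone `K` dominated by the zeros of `φ` in `K ∩ H`. -/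
def dominatedByZeros {W : Type*} [AddCommGroup W] [Module ℝ W] (K : ConvexCone ℝ W)
    (H : AffineSubspace ℝ W) (φ : W →ₗ[ℝ] ℝ) : Set W :=
  {y | y ∈ K ∧ ∃ (c : ℝ) (x : W), 0 < c ∧ x ∈ K ∧ x ∈ H ∧ φ x = 0 ∧ c • x - y ∈ K}

section dominatedByZeros

variable {W : Type*} [AddCommGroup W] [Module ℝ W] {K : ConvexCone ℝ W}
  {H : AffineSubspace ℝ W} {φ : W →ₗ[ℝ] ℝ}

theorem zero_mem_dominatedByZeros (h0 : (0 : W) ∈ K) {x : W} (hxK : x ∈ K) (hxH : x ∈ H)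
    (hx : φ x = 0) : (0 : W) ∈ dominatedByZeros K H φ :=
  ⟨h0, 1, x, one_pos, hxK, hxH, hx, by simpa using hxK⟩

theorem mem_dominatedByZeros_of_eq_zero (h0 : (0 : W) ∈ K) {x : W} (hxK : x ∈ K) (hxH : x ∈ H)
    (hx : φ x = 0) : x ∈ dominatedByZeros K H φ :=
  ⟨hxK, 1, x, one_pos, hxK, hxH, hx, by simpa using h0⟩

theorem add_mem_dominatedByZeros {y z : W} (hy : y ∈ dominatedByZeros K H φ)
    (hz : z ∈ dominatedByZeros K H φ) : y + z ∈ dominatedByZeros K H φ := by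
  obtain ⟨hyK, c, x, hc, hxK, hxH, hx, hcx⟩ := hy
  obtain ⟨hzK, c', x', hc', hxK', hxH', hx', hcx'⟩ := hz
  have hs : 0 < c + c' := by positivity
  have hsum : c / (c + c') + c' / (c + c') = 1 := by field_simp
  refine ⟨K.add_mem hyK hzK, c + c', (c / (c + c')) • x + (c' / (c + c')) • x', hs,
    K.add_mem (K.smul_mem (by positivity) hxK) (K.smul_mem (by positivity) hxK'),
    H.convex hxH hxH' (by positivity) (by positivity) hsum, by simp [hx, hx'], ?_⟩
  have : (c + c') • ((c / (c + c')) • x + (c' / (c + c')) • x') - (y + z)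
      = (c • x - y) + (c' • x' - z) := by
    rw [smul_add, smul_smul, smul_smul, mul_div_cancel₀ _ hs.ne', mul_div_cancel₀ _ hs.ne']
    abel
  rw [this]
  exact K.add_mem hcx hcx'

theorem mem_dominatedByZeros_of_add {y z : W} (hy : y ∈ K) (hz : z ∈ K)
    (h : y + z ∈ dominatedByZeros K H φ) : y ∈ dominatedByZeros K H φ := by
  obtain ⟨-, c, x, hc, hxK, hxH, hx, hcx⟩ := h
  refine ⟨hy, c, x, hc, hxK, hxH, hx, ?_⟩
  convert K.add_mem hcx hz using 1
  abel

theorem smul_mem_dominatedByZeros {a : ℝ} (ha : 0 < a) {y : W}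
    (hy : y ∈ dominatedByZeros K H φ) : a • y ∈ dominatedByZeros K H φ := by
  obtain ⟨hyK, c, x, hc, hxK, hxH, hx, hcx⟩ := hy
  refine ⟨K.smul_mem ha hyK, a * c, x, by positivity, hxK, hxH, hx, ?_⟩
  rw [mul_smul, ← smul_sub]
  exact K.smul_mem ha hcx

/-- If `φ` is nonnegative on `K ∩ H`, then it vanishes on all points of `H` dominated by
its zeros. -/
theorem eq_zero_of_mem_dominatedByZeros (hφ : ∀ x ∈ K, x ∈ H → 0 ≤ φ x) {y : W}
    (hy : y ∈ dominatedByZeros K H φ) (hyH : y ∈ H) : φ y = 0 := by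
  obtain ⟨hyK, c, x, hc, hxK, hxH, hx, hcx⟩ := hy
  refine le_antisymm ?_ (hφ y hyK hyH)
  have hmem : AffineMap.lineMap x y (-(1 / c)) ∈ H := AffineMap.lineMap_mem _ hxH hyH
  have heq : AffineMap.lineMap x y (-(1 / c)) = (1 / c) • x + (1 / c) • (c • x - y) := by
    rw [AffineMap.lineMap_apply_module', smul_sub, smul_sub, smul_smul,
      one_div_mul_cancel hc.ne', neg_smul, neg_smul, one_smul]
    abel
  rw [heq] at hmem
  have := hφ _ (K.add_mem (K.smul_mem (by positivity) hxK) (K.smul_mem (by positivity) hcx)) hmem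
  simp only [map_add, map_smul, map_sub, hx, smul_eq_mul, mul_zero, zero_sub, zero_add] at this
  have hc' : 0 < 1 / c := by positivity
  nlinarith

theorem sum_mem_dominatedByZeros {ι : Type*} (s : Finset ι) (f : ι → W)
    (h0 : (0 : W) ∈ dominatedByZeros K H φ) (h : ∀ i ∈ s, f i ∈ dominatedByZeros K H φ) :
    ∑ i ∈ s, f i ∈ dominatedByZeros K H φ :=
  Finset.sum_induction f (· ∈ dominatedByZeros K H φ)
    (fun _ _ => add_mem_dominatedByZeros) h0 h

theorem mem_dominatedByZeros_of_sum {ι : Type*} {s : Finset ι} {f : ι → W}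
    (hK0 : (0 : W) ∈ K) (hf : ∀ i ∈ s, f i ∈ K)
    (h : ∑ i ∈ s, f i ∈ dominatedByZeros K H φ) {i : ι} (hi : i ∈ s) :
    f i ∈ dominatedByZeros K H φ := by
  classical
  rw [← Finset.add_sum_erase s f hi] at h
  exact mem_dominatedByZeros_of_add (hf i hi) (Finset.sum_induction f (· ∈ K)
    (fun _ _ hx hy => K.add_mem hx hy) hK0 fun j hj => hf j (Finset.mem_of_mem_erase hj)) h

end dominatedByZeros

/-- `PSDTuple k m` as a convex cone. -/
def psdTupleCone (k m : ℕ) : ConvexCone ℝ (Fin m → Matrix (Fin k) (Fin k) ℝ) where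
  carrier := PSDTuple k m
  smul_mem' := fun _ hc _ hA i => (hA i).smul hc.le
  add_mem' := fun _ hA _ hB i => (hA i).add (hB i)

theorem zero_mem_psdTupleCone (k m : ℕ) : 0 ∈ psdTupleCone k m :=
  fun _ => Matrix.PosSemidef.zero

/-- The tuple with `v vᵀ` in position `i` and zeros elsewhere. -/
def rankOneTuple {k m : ℕ} (i : Fin m) (v : Fin k → ℝ) : Fin m → Matrix (Fin k) (Fin k) ℝ :=
  Pi.single i (Matrix.vecMulVec v v)

theorem rankOneTuple_mem {k m : ℕ} (i : Fin m) (v : Fin k → ℝ) :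
    rankOneTuple i v ∈ psdTupleCone k m := by
  intro j
  rcases eq_or_ne j i with rfl | h
  · rw [rankOneTuple, Pi.single_eq_same]
    simpa using Matrix.posSemidef_vecMulVec_self_star v
  · rw [rankOneTuple, Pi.single_eq_of_ne h]
    exact Matrix.PosSemidef.zero

theorem rankOneTuple_zero {k m : ℕ} (i : Fin m) : rankOneTuple i (0 : Fin k → ℝ) = 0 := by
  simp [rankOneTuple]

theorem rankOneTuple_smul {k m : ℕ} (i : Fin m) (c : ℝ) (v : Fin k → ℝ) :
    rankOneTuple i (c • v) = (c * c) • rankOneTuple i v := by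
  rw [rankOneTuple, rankOneTuple, ← Pi.single_smul]
  congr 1
  ext a b
  simp [Matrix.vecMulVec_apply]
  ring

theorem rankOneTuple_add_add_sub {k m : ℕ} (i : Fin m) (u v : Fin k → ℝ) :
    rankOneTuple i (u + v) + rankOneTuple i (u - v)
      = (2 : ℝ) • rankOneTuple i u + (2 : ℝ) • rankOneTuple i v := by
  simp only [rankOneTuple, ← Pi.single_smul, ← Pi.single_add]
  congr 1
  ext a b
  simp [Matrix.vecMulVec_apply]
  ring

open MatrixOrder in
theorem exists_eq_sum_rankOneTuple {k m : ℕ} {A : Fin m → Matrix (Fin k) (Fin k) ℝ}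
    (hA : A ∈ psdTupleCone k m) :
    ∃ v : Fin m → Fin k → Fin k → ℝ, A = ∑ x : Fin m × Fin k, rankOneTuple x.1 (v x.1 x.2) := by
  have h : ∀ i, ∃ B : Matrix (Fin k) (Fin k) ℝ, A i = star B * B := fun i =>
    CStarAlgebra.nonneg_iff_eq_star_mul_self.1 (Matrix.PosSemidef.nonneg (hA i))
  choose B hB using h
  refine ⟨B, ?_⟩
  have hi : ∀ i, A i = ∑ j, Matrix.vecMulVec (B i j) (B i j) := by
    intro i
    rw [hB i]
    ext a b
    simp [Matrix.star_eq_conjTranspose, Matrix.mul_apply, Matrix.sum_apply, Matrix.vecMulVec_apply]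
  rw [Fintype.sum_prod_type]
  conv_lhs => rw [← Finset.univ_sum_single A]
  refine Finset.sum_congr rfl fun i _ => ?_
  rw [hi i]
  exact map_sum (AddMonoidHom.single (fun _ : Fin m => Matrix (Fin k) (Fin k) ℝ) i) _ _

/-- The vectors `v` for which `v vᵀ`, placed in position `i`, is dominated by zeros of `φ`. -/
def dominatedSubspace {k m : ℕ} (H : AffineSubspace ℝ (Fin m → Matrix (Fin k) (Fin k) ℝ))
    (φ : (Fin m → Matrix (Fin k) (Fin k) ℝ) →ₗ[ℝ] ℝ)
    (h0 : 0 ∈ dominatedByZeros (psdTupleCone k m) H φ) (i : Fin m) :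
    Submodule ℝ (Fin k → ℝ) where
  carrier := {v | rankOneTuple i v ∈ dominatedByZeros (psdTupleCone k m) H φ}
  zero_mem' := by rwa [Set.mem_ofPred_eq, rankOneTuple_zero]
  add_mem' := fun {u v} hu hv => by
    refine mem_dominatedByZeros_of_add (rankOneTuple_mem i _) (rankOneTuple_mem i (u - v)) ?_
    rw [rankOneTuple_add_add_sub]
    exact add_mem_dominatedByZeros (smul_mem_dominatedByZeros two_pos hu)
      (smul_mem_dominatedByZeros two_pos hv)
  smul_mem' := fun c v hv => by
    rw [Set.mem_ofPred_eq, rankOneTuple_smul]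
    rcases eq_or_ne c 0 with rfl | hc
    · simpa using h0
    · exact smul_mem_dominatedByZeros (mul_self_pos.2 hc) hv

/-- Main theorem (Theorem 2.1): if `C ⊆ P_{n,2d}(X)` is a closed convex cone and `X` contains
finite subsets `S` of arbitrarily large cardinality such that every `k`-element subset `T ⊆ S`
is the zero set within `S` of some `f ∈ C`, then `C` has no `(𝒮₊ᵏ)^m`-lift for any `m`. -/
theorem stmt_0 (n d k : ℕ) (hn : 1 ≤ n)
    (X : Set (Fin n → ℝ)) (hX : (interior X).Nonempty)
    (C : Set (MvPolynomial (Fin n) ℝ))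
    (hCsub : C ⊆ PosCone n d X)
    (hclosed : IsClosed (coeffMap n '' C))
    (hsmul : ∀ (c : ℝ), 0 ≤ c → ∀ f ∈ C, c • f ∈ C)
    (hadd : ∀ f ∈ C, ∀ g ∈ C, f + g ∈ C)
    (hS : ∀ N : ℕ, ∃ S : Finset (Fin n → ℝ), (↑S : Set (Fin n → ℝ)) ⊆ X ∧ N ≤ S.card ∧
      ∀ T ⊆ S, T.card = k → ∃ f ∈ C, (∀ s ∈ T, MvPolynomial.eval s f = 0) ∧
        ∀ s ∈ S, s ∉ T → 0 < MvPolynomial.eval s f) :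
    ∀ m : ℕ, ¬ HasLift (PSDTuple k m) C := by
  classical
  rintro m ⟨H, p, rfl⟩
  let K := psdTupleCone k m
  let φ : (Fin n → ℝ) → (Fin m → Matrix (Fin k) (Fin k) ℝ) →ₗ[ℝ] ℝ := fun s =>
    (MvPolynomial.aeval s).toLinearMap ∘ₗ p
  have hφ_apply : ∀ s A, φ s A = MvPolynomial.eval s (p A) := fun s A => by
    simp [φ, MvPolynomial.aeval_eq_eval]
  obtain ⟨A₀, ⟨hA₀K, hA₀H⟩, hA₀⟩ : ∃ A, A ∈ PSDTuple k m ∩ (H : Set _) ∧ p A = 0 := by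
    obtain ⟨S, -, hcard, hST⟩ := hS k
    obtain ⟨T, hT, hTc⟩ := Finset.exists_subset_card_eq hcard
    obtain ⟨f, hf, -⟩ := hST T hT hTc
    simpa using hsmul 0 le_rfl f hf
  have h0 : ∀ s, 0 ∈ dominatedByZeros K H (φ s) := fun s =>
    zero_mem_dominatedByZeros (zero_mem_psdTupleCone k m) hA₀K hA₀H (by simp [hφ_apply, hA₀])
  obtain ⟨N, hN⟩ := exists_card_forall_inf_le (Fin n → ℝ) ℝ (Fin k → ℝ) (Fin m) Finset.univ (k + 1)
  obtain ⟨S, hSX, hcard, hST⟩ := hS N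
  obtain ⟨S', hS', hc, h⟩ := hN S (fun i s => dominatedSubspace H (φ s) (h0 s) i) hcard
  obtain ⟨T, hT, hTc⟩ := Finset.exists_subset_card_eq (s := S') (n := k) (by omega)
  obtain ⟨s, hs, hsT⟩ := Finset.exists_mem_notMem_of_card_lt_card (s := T) (t := S') (by omega)
  obtain ⟨_, ⟨A, ⟨hAK, hAH⟩, rfl⟩, hzero, hpos⟩ := hST T (hT.trans hS') hTc
  have hA_mem : A ∈ dominatedByZeros K H (φ s) := by
    obtain ⟨v, hv⟩ := exists_eq_sum_rankOneTuple (k := k) (m := m) hAK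
    have key : ∀ x : Fin m × Fin k,
        rankOneTuple x.1 (v x.1 x.2) ∈ dominatedByZeros K H (φ s) := by
      intro x
      refine h x.1 (Finset.mem_univ _) T hT (by simpa using hTc) s hs ?_
      rw [Submodule.mem_finsetInf]
      intro t ht
      have hAt : A ∈ dominatedByZeros K H (φ t) :=
        mem_dominatedByZeros_of_eq_zero (zero_mem_psdTupleCone k m) hAK hAH
          ((hφ_apply t A).trans (hzero t ht))
      rw [hv] at hAt
      exact mem_dominatedByZeros_of_sum (zero_mem_psdTupleCone k m)
        (fun y _ => rankOneTuple_mem _ _) hAt (Finset.mem_univ x)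
    rw [hv]
    exact sum_mem_dominatedByZeros _ _ (h0 s) fun x _ => key x
  have hφ : ∀ x ∈ K, x ∈ H → 0 ≤ φ s x := fun x hxK hxH => by
    rw [hφ_apply]
    exact (hCsub ⟨x, ⟨hxK, hxH⟩, rfl⟩).2 s (hSX (hS' hs))
  have := eq_zero_of_mem_dominatedByZeros hφ hA_mem hAH
  rw [hφ_apply] at this
  exact (hpos s (hS' hs) hsT).ne' this
end

section
/- Let X ⊆ ℝ^n be a set with non-empty interior and let C be a closed convex cone with Σ_{n,2d} ⊆ C ⊆ P_{n,2d}(X). Then sxdeg(C) ≥ C(n+d,n); that is, C has no ((𝒮₊ᵏ)^m)-lift whenever k < C(n+d,n). -/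
open MvPolynomial

/-- If `ker B ⊆ ker A`, then `‖A v‖²` is bounded by a constant multiple of `‖B v‖²`. -/
lemma exists_dotProduct_mulVec_le {k : ℕ} {A B : Matrix (Fin k) (Fin k) ℝ}
    (h : LinearMap.ker B.mulVecLin ≤ LinearMap.ker A.mulVecLin) :
    ∃ c : ℝ, 0 ≤ c ∧ ∀ v, A.mulVec v ⬝ᵥ A.mulVec v ≤ c * (B.mulVec v ⬝ᵥ B.mulVec v) := by
  obtain ⟨g, hg⟩ := LinearMap.exists_extend
    ((LinearMap.ker B.mulVecLin).liftQ A.mulVecLin h ∘ₗ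
      B.mulVecLin.quotKerEquivRange.symm.toLinearMap)
  have hgv (v : Fin k → ℝ) : g (B.mulVec v) = A.mulVec v := by
    have := LinearMap.congr_fun hg (B.mulVecLin.quotKerEquivRange (Submodule.Quotient.mk v))
    simpa using this
  set M := LinearMap.toMatrix' g with hM
  refine ⟨∑ i, ∑ j, M i j ^ 2, by positivity, fun v => ?_⟩
  have hMv : A.mulVec v = M.mulVec (B.mulVec v) := by
    rw [hM, LinearMap.toMatrix'_mulVec, hgv]
  rw [hMv, Finset.sum_mul]
  refine Finset.sum_le_sum fun i _ => ?_
  have := Finset.sum_mul_sq_le_sq_mul_sq Finset.univ (M i) (B.mulVec v)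
  simpa [Matrix.mulVec, dotProduct, sq] using this

open scoped MatrixOrder in
/-- A positive semidefinite matrix is dominated by a multiple of any other one whose kernel is
smaller. -/
lemma Matrix.PosSemidef.exists_smul_sub {k : ℕ} {A B : Matrix (Fin k) (Fin k) ℝ}
    (hA : A.PosSemidef) (hB : B.PosSemidef)
    (h : LinearMap.ker B.mulVecLin ≤ LinearMap.ker A.mulVecLin) :
    ∃ c : ℝ, 0 ≤ c ∧ (c • B - A).PosSemidef := by
  obtain ⟨S, rfl⟩ := CStarAlgebra.nonneg_iff_eq_star_mul_self.mp hA.nonneg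
  obtain ⟨T, rfl⟩ := CStarAlgebra.nonneg_iff_eq_star_mul_self.mp hB.nonneg
  simp only [Matrix.star_eq_conjTranspose] at *
  have hker : LinearMap.ker T.mulVecLin ≤ LinearMap.ker S.mulVecLin := fun v hv => by
    have hv' : v ∈ LinearMap.ker (Matrix.mulVecLin (S.conjTranspose * S)) := h (by
      simp only [LinearMap.mem_ker, Matrix.mulVecLin_apply] at hv ⊢
      rw [← Matrix.mulVec_mulVec, hv, Matrix.mulVec_zero])
    rwa [Matrix.ker_mulVecLin_conjTranspose_mul_self] at hv'
  obtain ⟨c, hc, hle⟩ := exists_dotProduct_mulVec_le hker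
  refine ⟨c, hc, .of_dotProduct_mulVec_nonneg ?_ fun v => ?_⟩
  · exact (hB.smul hc).isHermitian.sub hA.isHermitian
  · have hsq (R : Matrix (Fin k) (Fin k) ℝ) :
        v ⬝ᵥ (R.conjTranspose * R).mulVec v = R.mulVec v ⬝ᵥ R.mulVec v := by
      rw [← Matrix.mulVec_mulVec, Matrix.dotProduct_mulVec,
        Matrix.conjTranspose_eq_transpose_of_trivial, Matrix.vecMul_transpose]
    rw [star_trivial, Matrix.sub_mulVec, Matrix.smul_mulVec, dotProduct_sub, dotProduct_smul,
      hsq, hsq, smul_eq_mul]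
    linarith [hle v]

lemma Matrix.PosSemidef.exists_forall_ge_smul_sub {k : ℕ} {A B : Matrix (Fin k) (Fin k) ℝ}
    (hA : A.PosSemidef) (hB : B.PosSemidef)
    (h : LinearMap.ker B.mulVecLin ≤ LinearMap.ker A.mulVecLin) :
    ∃ c : ℝ, ∀ c' ≥ c, (c' • B - A).PosSemidef := by
  obtain ⟨c, -, hc⟩ := hA.exists_smul_sub hB h
  refine ⟨c, fun c' hc' => ?_⟩
  convert hc.add (hB.smul (sub_nonneg.2 hc')) using 1
  module

lemma Matrix.PosSemidef.ker_mulVecLin_add_le {k : ℕ} {A B : Matrix (Fin k) (Fin k) ℝ}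
    (hA : A.PosSemidef) (hB : B.PosSemidef) :
    LinearMap.ker (A + B).mulVecLin ≤ LinearMap.ker B.mulVecLin := fun v hv => by
  have h0 : star v ⬝ᵥ (A + B).mulVec v = 0 :=
    ((hA.add hB).dotProduct_mulVec_zero_iff v).2 hv
  rw [Matrix.add_mulVec, dotProduct_add] at h0
  have h1 := hA.dotProduct_mulVec_nonneg v
  have h2 := hB.dotProduct_mulVec_nonneg v
  exact (hB.dotProduct_mulVec_zero_iff v).1 (by linarith)

/-- A face of a spectrahedron cut out by a nonnegative functional `L` is described by
containment of kernels. -/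
lemma exists_kernels_of_face {k m : ℕ} (H : AffineSubspace ℝ (Fin m → Matrix (Fin k) (Fin k) ℝ))
    (L : (Fin m → Matrix (Fin k) (Fin k) ℝ) →ₗ[ℝ] ℝ)
    (hL : ∀ A ∈ PSDTuple k m ∩ (H : Set _), 0 ≤ L A)
    (hne : ∃ A ∈ PSDTuple k m ∩ (H : Set _), L A = 0) :
    ∃ U : Fin m → Submodule ℝ (Fin k → ℝ), ∀ A ∈ PSDTuple k m ∩ (H : Set _),
      L A = 0 ↔ ∀ i, U i ≤ LinearMap.ker (A i).mulVecLin := by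
  let F : Set (Fin m → Matrix (Fin k) (Fin k) ℝ) :=
    {A | A ∈ PSDTuple k m ∩ (H : Set _) ∧ L A = 0}
  have hF : F.Nonempty := hne
  let rk : (Fin m → Matrix (Fin k) (Fin k) ℝ) → ℕ :=
    fun A => ∑ i, Module.finrank ℝ (LinearMap.ker (A i).mulVecLin)
  let B := Function.argminOn rk F hF
  obtain ⟨⟨hBpsd, hBH⟩, hBL⟩ : B ∈ F := Function.argminOn_mem rk F hF
  refine ⟨fun i => LinearMap.ker (B i).mulVecLin, fun A ⟨hApsd, hAH⟩ =>
    ⟨fun hAL => ?_, fun hU => ?_⟩⟩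
  · let D : Fin m → Matrix (Fin k) (Fin k) ℝ := AffineMap.lineMap A B (1 / 2 : ℝ)
    have hD : D = (1 / 2 : ℝ) • (A + B) := by
      simp only [D, AffineMap.lineMap_apply_module]; module
    have hDF : D ∈ F := by
      refine ⟨⟨fun i => ?_, AffineMap.lineMap_mem _ hAH hBH⟩, ?_⟩
      · rw [hD]
        exact ((hApsd i).add (hBpsd i)).smul (one_half_pos (α := ℝ)).le
      · rw [hD, map_smul, map_add, hAL, hBL]; simp
    have hker (i) : LinearMap.ker (D i).mulVecLin = LinearMap.ker (A i + B i).mulVecLin := by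
      ext v
      simp [hD, -smul_add]
    have hle (i) : LinearMap.ker (D i).mulVecLin ≤ LinearMap.ker (B i).mulVecLin := by
      rw [hker]; exact (hApsd i).ker_mulVecLin_add_le (hBpsd i)
    have hmin : rk B ≤ rk D := Function.argminOn_le rk F hDF
    have heq := (Finset.sum_eq_sum_iff_of_le
      (fun i _ => Submodule.finrank_mono (hle i))).1
      (le_antisymm (Finset.sum_le_sum fun i _ => Submodule.finrank_mono (hle i)) hmin)
    intro i
    change LinearMap.ker (B i).mulVecLin ≤ _
    rw [← Submodule.eq_of_le_of_finrank_eq (hle i) (heq i (Finset.mem_univ i)), hker, add_comm]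
    exact (hBpsd i).ker_mulVecLin_add_le (hApsd i)
  · choose c hc using fun i => (hApsd i).exists_forall_ge_smul_sub (hBpsd i) (hU i)
    obtain ⟨c', hc'⟩ : ∃ c', ∀ i, c i ≤ c' := (Finite.bddAbove_range c).imp fun _ h i =>
      h ⟨i, rfl⟩
    set t : ℝ := max c' 2
    have ht : 2 ≤ t := le_max_right _ _
    have hs : 0 < t - 1 := by linarith
    let D : Fin m → Matrix (Fin k) (Fin k) ℝ := AffineMap.lineMap A B (t / (t - 1))
    have hD : D = (t - 1)⁻¹ • (t • B - A) := by
      have h1 : 1 - t / (t - 1) = -(t - 1)⁻¹ := by field_simp; ring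
      simp only [D, AffineMap.lineMap_apply_module, h1]
      rw [div_eq_inv_mul]
      module
    have hLD : 0 ≤ L D := by
      refine hL D ⟨fun i => ?_, AffineMap.lineMap_mem _ hAH hBH⟩
      rw [hD]
      exact (hc i t ((hc' i).trans (le_max_left _ _))).smul (inv_nonneg.2 hs.le)
    rw [hD, map_smul, map_sub, map_smul, hBL, smul_zero, zero_sub, smul_eq_mul] at hLD
    have := nonneg_of_mul_nonneg_right hLD (inv_pos.2 hs)
    linarith [hL A ⟨hApsd, hAH⟩]

/-- Given finitely many families of subspaces of `ℝᵏ` and an ultrafilter on the common index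
set, at most `k` indices suffice for the sums of the chosen subspaces to contain eventually all
the others, simultaneously for all families. -/
lemma exists_finset_eventually_le_sup {α ι : Type*} [Finite ι] {k : ℕ} (u : Ultrafilter α)
    (U : α → ι → Submodule ℝ (Fin k → ℝ)) :
    ∃ S : Finset α, S.card ≤ k ∧ ∀ᶠ x in (u : Filter α), ∀ i, U x i ≤ S.sup fun s => U s i := by
  classical
  suffices h : ∀ r : ℕ, ∃ S : Finset α, S.card ≤ r ∧ ∀ i,
      (∀ᶠ x in (u : Filter α), U x i ≤ S.sup fun s => U s i) ∨
        r ≤ Module.finrank ℝ ↥(S.sup fun s => U s i) by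
    obtain ⟨S, hS, h⟩ := h k
    refine ⟨S, hS, Filter.eventually_all.2 fun i => (h i).elim id fun hk => ?_⟩
    have htop : (S.sup fun s => U s i) = ⊤ :=
      Submodule.eq_top_of_finrank_eq ((Submodule.finrank_le _).antisymm (by simpa using hk))
    simp [htop]
  intro r
  induction r with
  | zero => exact ⟨∅, by simp⟩
  | succ r ih =>
    obtain ⟨S, hS, h⟩ := ih
    have key : ∀ᶠ x in (u : Filter α), ∀ i,
        (∀ᶠ y in (u : Filter α), U y i ≤ S.sup fun s => U s i) ∨
          ¬ U x i ≤ S.sup fun s => U s i := by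
      refine Filter.eventually_all.2 fun i => ?_
      by_cases hi : ∀ᶠ y in (u : Filter α), U y i ≤ S.sup fun s => U s i
      · exact .of_forall fun _ => .inl hi
      · exact (Ultrafilter.eventually_not.2 hi).mono fun _ => .inr
    obtain ⟨x, hx⟩ := key.exists
    refine ⟨insert x S, (Finset.card_insert_le _ _).trans (by lia), fun i => ?_⟩
    rw [Finset.sup_insert]
    rcases hx i with hi | hi
    · exact .inl (hi.mono fun _ hy => hy.trans le_sup_right)
    rcases h i with hi' | hi'
    · exact .inl (hi'.mono fun _ hy => hy.trans le_sup_right)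
    · refine .inr (hi'.trans_lt (Submodule.finrank_lt_finrank_of_lt ?_))
      exact lt_of_le_not_ge le_sup_right fun hle => hi (le_sup_left.trans hle)

lemma sum_range_multichoose (n d : ℕ) :
    ∑ j ∈ Finset.range (d + 1), n.multichoose j = (n + d).choose n := by
  have h : ∑ j ∈ Finset.range (d + 1), n.multichoose j = (n + 1).multichoose d := by
    induction d with
    | zero => simp
    | succ d ih => rw [Finset.sum_range_succ, ih, Nat.multichoose_succ_succ, add_comm]
  rw [h, Nat.multichoose_eq, Nat.choose_symm_add]
  congr 1
  lia

lemma choose_le_finrank_restrictTotalDegree (n d : ℕ) :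
    (n + d).choose n ≤ Module.finrank ℝ (restrictTotalDegree (Fin n) ℝ d) := by
  classical
  have hb := basisRestrictSupport ℝ {a : Fin n →₀ ℕ | (a.sum fun _ e => e) ≤ d}
  let T := (Finset.range (d + 1)).biUnion (Finset.finsuppAntidiag (Finset.univ : Finset (Fin n)))
  have hT : {a : Fin n →₀ ℕ | (a.sum fun _ e => e) ≤ d} = T := by
    ext a
    simp [T, Finsupp.sum_fintype]
  have hcard : T.card = (n + d).choose n := by
    rw [Finset.card_biUnion, ← sum_range_multichoose]
    · simp [Finset.card_finsuppAntidiag_nat_eq_multichoose]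
    · intro i _ j _ hij
      refine Finset.disjoint_left.2 fun a hi hj => hij ?_
      rw [Finset.mem_finsuppAntidiag] at hi hj
      exact hi.1.symm.trans hj.1
  rw [restrictTotalDegree, Module.finrank_eq_nat_card_basis hb, hT]
  simp [hcard]

/-- Fewer than `(n + d).choose n` points lie on a hypersurface of degree at most `d`. -/
lemma exists_ne_zero_totalDegree_le_eval_eq_zero {n d : ℕ} (S : Finset (Fin n → ℝ))
    (hS : S.card < (n + d).choose n) :
    ∃ p : MvPolynomial (Fin n) ℝ, p ≠ 0 ∧ p.totalDegree ≤ d ∧ ∀ s ∈ S, eval s p = 0 := by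
  let ev : restrictTotalDegree (Fin n) ℝ d →ₗ[ℝ] (S → ℝ) :=
    LinearMap.pi fun s => (aeval s.1).toLinearMap ∘ₗ (restrictTotalDegree (Fin n) ℝ d).subtype
  have hker : LinearMap.ker ev ≠ ⊥ := LinearMap.ker_ne_bot_of_finrank_lt (by
    simpa using hS.trans_le (choose_le_finrank_restrictTotalDegree n d))
  obtain ⟨p, hp, hp0⟩ := Submodule.exists_mem_ne_zero_of_ne_bot hker
  refine ⟨p, by simpa using hp0, (mem_restrictTotalDegree _ _ _).1 p.2, fun s hs => ?_⟩
  have := congr_fun (LinearMap.mem_ker.1 hp) ⟨s, hs⟩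
  simpa [ev, coe_aeval_eq_eval] using this

lemma exists_mem_eval_ne_zero {n : ℕ} {X : Set (Fin n → ℝ)} (hX : (interior X).Nonempty)
    {p : MvPolynomial (Fin n) ℝ} (hp : p ≠ 0) : ∃ x ∈ X, eval x p ≠ 0 := by
  by_contra! h
  obtain ⟨x, hx⟩ := hX
  obtain ⟨ε, hε, hball⟩ := Metric.mem_nhds_iff.1 (mem_interior_iff_mem_nhds.1 hx)
  refine hp (funext_set (fun i => Metric.ball (x i) ε) (fun i => ?_) fun y hy => ?_)
  · rw [Real.ball_eq_Ioo]
    exact Set.Ioo_infinite (by linarith)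
  · rw [map_zero]
    exact h y (hball (by rwa [ball_pi _ hε]))

/-- There is an ultrafilter on a set with nonempty interior which contains no proper algebraic
subset. -/
lemma exists_ultrafilter_eval_ne_zero {n : ℕ} {X : Set (Fin n → ℝ)}
    (hX : (interior X).Nonempty) :
    ∃ u : Ultrafilter X, ∀ p : MvPolynomial (Fin n) ℝ, p ≠ 0 →
      ∀ᶠ x in (u : Filter X), eval x.1 p ≠ 0 := by
  let f : Filter X := ⨅ p : {p : MvPolynomial (Fin n) ℝ // p ≠ 0},
    Filter.principal {x : X | eval x.1 p.1 ≠ 0}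
  have : Nonempty {p : MvPolynomial (Fin n) ℝ // p ≠ 0} := ⟨⟨1, one_ne_zero⟩⟩
  have hf : f.NeBot := by
    refine Filter.iInf_neBot_of_directed' (fun p q => ?_) fun p => ?_
    · refine ⟨⟨p.1 * q.1, mul_ne_zero p.2 q.2⟩, ?_, ?_⟩ <;>
      · simp only [ge_iff_le, Filter.le_principal_iff, Filter.mem_principal]
        intro x hx
        simp only [Set.mem_ofPred_eq, map_mul, ne_eq, mul_eq_zero, not_or] at hx ⊢
        first | exact hx.1 | exact hx.2
    · obtain ⟨x, hx, hpx⟩ := exists_mem_eval_ne_zero hX p.2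
      exact Filter.principal_neBot_iff.2 ⟨⟨x, hx⟩, hpx⟩
  refine ⟨Ultrafilter.of f, fun p hp => Ultrafilter.of_le f ?_⟩
  exact Filter.mem_iInf_of_mem ⟨p, hp⟩ (Filter.mem_principal_self _)

lemma not_hasLift_of_lt_choose {n d : ℕ} {X : Set (Fin n → ℝ)} (hX : (interior X).Nonempty)
    {C : Set (MvPolynomial (Fin n) ℝ)} (hlow : SOSCone n d ⊆ C) (hup : C ⊆ PosCone n d X)
    {k m : ℕ} (hk : k < (n + d).choose n) : ¬ HasLift (PSDTuple k m) C := by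
  rintro ⟨H, π, rfl⟩
  classical
  have hface (x : X) := exists_kernels_of_face H ((aeval x.1).toLinearMap ∘ₗ π)
    (fun A hA => by simpa [coe_aeval_eq_eval] using (hup ⟨A, hA, rfl⟩).2 x x.2) (by
      obtain ⟨A, hA, hA0⟩ := hlow (show (0 : MvPolynomial (Fin n) ℝ) ∈ SOSCone n d from
        ⟨by simp, 0, Fin.elim0, by simp⟩)
      exact ⟨A, hA, by simp [hA0]⟩)
  choose U hU using hface
  obtain ⟨u, hu⟩ := exists_ultrafilter_eval_ne_zero hX
  obtain ⟨S, hS, hev⟩ := exists_finset_eventually_le_sup u U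
  obtain ⟨p, hp0, hpd, hpS⟩ := exists_ne_zero_totalDegree_le_eval_eq_zero
    (S.map (Function.Embedding.subtype _)) (by simpa using hS.trans_lt hk)
  obtain ⟨A, hA, hAp⟩ := hlow (show p ^ 2 ∈ SOSCone n d from
    ⟨(totalDegree_pow p 2).trans (by lia), 1, fun _ => p, by simp⟩)
  have hzero (x : X) : eval x.1 p = 0 ↔ ∀ i, U x i ≤ LinearMap.ker (A i).mulVecLin := by
    rw [← hU x A hA]
    simp [hAp]
  obtain ⟨x, hxU, hxp⟩ := (hev.and (hu p hp0)).exists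
  refine hxp ((hzero x).2 fun i => (hxU i).trans (Finset.sup_le fun s hs => ?_))
  exact (hzero s).1 (hpS s (Finset.mem_map_of_mem _ hs)) i

/-- Corollary 2.2: a closed convex cone `C` with `Σ_{n,2d} ⊆ C ⊆ P_{n,2d}(X)`, where `X` has
nonempty interior, satisfies `sxdeg(C) ≥ C(n+d,n)`. -/
theorem stmt_1 (n d : ℕ) (hn : 1 ≤ n)
    (X : Set (Fin n → ℝ)) (hX : (interior X).Nonempty)
    (C : Set (MvPolynomial (Fin n) ℝ))
    (hlow : SOSCone n d ⊆ C) (hup : C ⊆ PosCone n d X)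
    (hclosed : IsClosed (coeffMap n '' C))
    (hsmul : ∀ (c : ℝ), 0 ≤ c → ∀ f ∈ C, c • f ∈ C)
    (hadd : ∀ f ∈ C, ∀ g ∈ C, f + g ∈ C) :
    (Nat.choose (n + d) n : ℕ∞) ≤ sxdeg C ∧
    ∀ k m : ℕ, k < Nat.choose (n + d) n → ¬ HasLift (PSDTuple k m) C := by
  refine ⟨le_sInf ?_, fun k m hk => not_hasLift_of_lt_choose hX hlow hup hk⟩
  rintro _ ⟨k, m, rfl, hlift⟩
  by_contra! hk
  exact not_hasLift_of_lt_choose hX hlow hup (Nat.cast_lt.1 hk) hlift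
end

section
/- For all n ∈ ℕ and d ∈ ℕ, sxdeg(Σ_{n,2d}) = sxc(Σ_{n,2d}) = C(n+d,n). Concretely: Σ_{n,2d} has a 𝒮₊ᵏ-lift with k = C(n+d,n) (namely Σ_{n,2d} = { v_{n,d}ᵀ A v_{n,d} : A ∈ 𝒮₊ᵏ }, where v_{n,d} is the vector of all monomials of degree at most d in n variables), and Σ_{n,2d} has no ((𝒮₊ᵏ)^m)-lift for any m when k < C(n+d,n). -/
open MvPolynomial

/-- Index type for the monomials `x^α` with `|α| ≤ d` in `n` variables
(there are `C(n+d,n)` of them). -/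
def MonIdx (n d : ℕ) : Type := {v : Fin n → Fin (d + 1) // (∑ i, (v i : ℕ)) ≤ d}

noncomputable instance (n d : ℕ) : Fintype (MonIdx n d) := by
  unfold MonIdx; infer_instance

instance (n d : ℕ) : DecidableEq (MonIdx n d) := by
  unfold MonIdx; infer_instance

open Matrix in
/-- If `ker A₀ ⊆ ker A` for positive semidefinite `A₀`, `A`, then `A` is dominated by a multiple
of `A₀`. -/
theorem Matrix.PosSemidef.exists_dotProduct_le_of_ker_le {k : ℕ} {A₀ A : Matrix (Fin k) (Fin k) ℝ}
    (h₀ : A₀.PosSemidef) (h : A.PosSemidef)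
    (hker : LinearMap.ker A₀.mulVecLin ≤ LinearMap.ker A.mulVecLin) :
    ∃ M : ℝ, 0 ≤ M ∧ ∀ v : Fin k → ℝ, v ⬝ᵥ A *ᵥ v ≤ M * (v ⬝ᵥ A₀ *ᵥ v) := by
  open scoped MatrixOrder in
  obtain ⟨B, rfl⟩ := CStarAlgebra.nonneg_iff_eq_star_mul_self.mp h₀.nonneg
  open scoped MatrixOrder in
  obtain ⟨D, rfl⟩ := CStarAlgebra.nonneg_iff_eq_star_mul_self.mp h.nonneg
  have key : ∀ (B : Matrix (Fin k) (Fin k) ℝ) (v : Fin k → ℝ),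
      v ⬝ᵥ (star B * B) *ᵥ v = ∑ i, ((B *ᵥ v) i) ^ 2 := by
    intro B v
    rw [← mulVec_mulVec, dotProduct_mulVec, star_eq_conjTranspose, conjTranspose_eq_transpose_of_trivial,
      vecMul_transpose]
    simp [dotProduct, sq]
  have hmem : ∀ i, (LinearMap.proj i).comp D.mulVecLin ∈
      Submodule.span ℝ (Set.range fun j => (LinearMap.proj (R := ℝ) (φ := fun _ : Fin k => ℝ) j).comp
        B.mulVecLin) := by
    intro i
    refine mem_span_of_iInf_ker_le_ker fun v hv => ?_
    have hB : B *ᵥ v = 0 := by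
      ext j
      simpa using (Submodule.mem_iInf _).1 hv j
    have h1 : v ∈ LinearMap.ker (star D * D).mulVecLin := by
      apply hker
      simp [hB]
    have h2 : v ⬝ᵥ (star D * D) *ᵥ v = 0 := by
      have : (star D * D) *ᵥ v = 0 := by simpa using h1
      rw [this, dotProduct_zero]
    rw [key, Finset.sum_eq_zero_iff_of_nonneg fun _ _ => sq_nonneg _] at h2
    simpa using h2 i (Finset.mem_univ i)
  choose E hE using fun i => (Submodule.mem_span_range_iff_exists_fun ℝ).1 (hmem i)
  have hDE : ∀ i v, (D *ᵥ v) i = ∑ j, E i j * (B *ᵥ v) j := by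
    intro i v
    have := LinearMap.congr_fun (hE i) v
    simpa using this.symm
  refine ⟨∑ i, ∑ j, E i j ^ 2, Finset.sum_nonneg fun i _ => Finset.sum_nonneg fun j _ => sq_nonneg _,
    fun v => ?_⟩
  rw [key, key, Finset.sum_mul]
  refine Finset.sum_le_sum fun i _ => ?_
  rw [hDE]
  exact Finset.sum_mul_sq_le_sq_mul_sq _ _ _

/-- In an affine slice of the cone of tuples of positive semidefinite matrices,
a nonnegative linear functional vanishing at a point vanishes at every point of larger kernel. -/
theorem eval_eq_zero_of_ker_le {k m : ℕ}
    (H : AffineSubspace ℝ (Fin m → Matrix (Fin k) (Fin k) ℝ))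
    (L : (Fin m → Matrix (Fin k) (Fin k) ℝ) →ₗ[ℝ] ℝ)
    (hL : ∀ A ∈ PSDTuple k m ∩ H, 0 ≤ L A) {A₀ A : Fin m → Matrix (Fin k) (Fin k) ℝ}
    (hA₀ : A₀ ∈ PSDTuple k m ∩ H) (hA : A ∈ PSDTuple k m ∩ H) (h0 : L A₀ = 0)
    (hker : ∀ i, LinearMap.ker (A₀ i).mulVecLin ≤ LinearMap.ker (A i).mulVecLin) :
    L A = 0 := by
  choose M hM0 hM using fun i => (hA₀.1 i).exists_dotProduct_le_of_ker_le (hA.1 i) (hker i)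
  set N : ℝ := 1 + ∑ i, M i with hN
  have hMs : 0 ≤ ∑ i, M i := Finset.sum_nonneg fun i _ => hM0 i
  have hNpos : 0 < N := by positivity
  have hmem : AffineMap.lineMap A₀ A (-N⁻¹) ∈ PSDTuple k m ∩ H := by
    refine ⟨fun i => ?_, AffineMap.lineMap_mem _ hA₀.2 hA.2⟩
    have hi : AffineMap.lineMap A₀ A (-N⁻¹) i = (1 + N⁻¹) • A₀ i - N⁻¹ • A i := by
      simp [AffineMap.lineMap_apply_module, sub_eq_add_neg]
    rw [hi]
    refine Matrix.PosSemidef.of_dotProduct_mulVec_nonneg ?_ fun v => ?_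
    · have h1 := (hA₀.1 i).1
      have h2 := (hA.1 i).1
      simp only [Matrix.IsHermitian, Matrix.conjTranspose_eq_transpose_of_trivial] at h1 h2 ⊢
      simp [h1, h2]
    · have h1 := hM i v
      have h2 : 0 ≤ v ⬝ᵥ (A₀ i).mulVec v := by simpa using (hA₀.1 i).dotProduct_mulVec_nonneg v
      have h3 : M i ≤ N := by
        have := Finset.single_le_sum (fun i _ => hM0 i) (Finset.mem_univ i)
        linarith
      have h4 : N⁻¹ * (v ⬝ᵥ (A i).mulVec v) ≤ v ⬝ᵥ (A₀ i).mulVec v := by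
        rw [inv_mul_le_iff₀ hNpos]
        exact h1.trans (mul_le_mul_of_nonneg_right h3 h2)
      have h5 : 0 ≤ N⁻¹ * (v ⬝ᵥ (A₀ i).mulVec v) := by positivity
      simp only [star_trivial, Matrix.sub_mulVec, Matrix.smul_mulVec, dotProduct_sub,
        dotProduct_smul, smul_eq_mul]
      linarith
  have h1 := hL _ hmem
  have h2 := hL _ hA
  simp only [AffineMap.lineMap_apply_module, map_add, map_smul, h0, smul_eq_mul] at h1
  have : 0 < N⁻¹ := by positivity
  nlinarith

/-- A nonempty convex set of tuples of positive semidefinite matrices has an element whose kernels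
are contained in those of all other elements. -/
theorem exists_forall_ker_le {k m : ℕ} {F : Set (Fin m → Matrix (Fin k) (Fin k) ℝ)}
    (hF : F ⊆ PSDTuple k m) (hconv : Convex ℝ F) (hne : F.Nonempty) :
    ∃ A₀ ∈ F, ∀ A ∈ F, ∀ i, LinearMap.ker (A₀ i).mulVecLin ≤ LinearMap.ker (A i).mulVecLin := by
  set φ : (Fin m → Matrix (Fin k) (Fin k) ℝ) → ℕ :=
    fun A => ∑ i, Module.finrank ℝ (LinearMap.ker (A i).mulVecLin) with hφ
  obtain ⟨A₀, hA₀, hmin⟩ : ∃ A₀ ∈ F, ∀ A ∈ F, φ A₀ ≤ φ A := by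
    have hex : ∃ r, ∃ A ∈ F, φ A = r := ⟨_, _, hne.some_mem, rfl⟩
    classical
    obtain ⟨A₀, h1, h2⟩ := Nat.find_spec hex
    exact ⟨A₀, h1, fun A hA => h2 ▸ Nat.find_min' hex ⟨A, hA, rfl⟩⟩
  refine ⟨A₀, hA₀, fun A hA => ?_⟩
  set S := (2⁻¹ : ℝ) • A₀ + (2⁻¹ : ℝ) • A with hS
  have hSF : S ∈ F := hconv hA₀ hA (by norm_num) (by norm_num) (by norm_num)
  have hle : ∀ i, LinearMap.ker (S i).mulVecLin ≤
      LinearMap.ker (A₀ i).mulVecLin ⊓ LinearMap.ker (A i).mulVecLin := by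
    intro i v hv
    have hv' : (S i).mulVec v = 0 := by simpa using hv
    have hsum : v ⬝ᵥ (S i).mulVec v = 0 := by rw [hv', dotProduct_zero]
    have h1 : 0 ≤ v ⬝ᵥ (A₀ i).mulVec v := by
      simpa using (hF hA₀ i).dotProduct_mulVec_nonneg v
    have h2 : 0 ≤ v ⬝ᵥ (A i).mulVec v := by simpa using (hF hA i).dotProduct_mulVec_nonneg v
    simp only [hS, Pi.add_apply, Pi.smul_apply, Matrix.add_mulVec, Matrix.smul_mulVec,
      dotProduct_add, dotProduct_smul, smul_eq_mul] at hsum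
    have h3 := ((hF hA₀ i).dotProduct_mulVec_zero_iff v).1 (by rw [star_trivial]; linarith)
    have h4 := ((hF hA i).dotProduct_mulVec_zero_iff v).1 (by rw [star_trivial]; linarith)
    exact ⟨by simpa using h3, by simpa using h4⟩
  intro i
  have hranks : ∀ i ∈ Finset.univ, Module.finrank ℝ (LinearMap.ker (S i).mulVecLin) ≤
      Module.finrank ℝ (LinearMap.ker (A₀ i).mulVecLin) :=
    fun i _ => Submodule.finrank_mono ((hle i).trans inf_le_left)
  have heq := (Finset.sum_eq_sum_iff_of_le hranks).1
    (le_antisymm (Finset.sum_le_sum hranks) (hmin S hSF)) i (Finset.mem_univ i)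
  rw [← Submodule.eq_of_le_of_finrank_eq ((hle i).trans inf_le_left) heq]
  exact (hle i).trans inf_le_right

/-- A set of points is Zariski dense if only the zero polynomial vanishes on it. -/
def ZariskiDense {n : ℕ} (S : Set (Fin n → ℝ)) : Prop :=
  ∀ p : MvPolynomial (Fin n) ℝ, (∀ x ∈ S, eval x p = 0) → p = 0

theorem zariskiDense_univ (n : ℕ) : ZariskiDense (Set.univ : Set (Fin n → ℝ)) :=
  fun p hp => MvPolynomial.funext fun x => by simpa using hp x trivial

theorem ZariskiDense.nonempty {n : ℕ} {S : Set (Fin n → ℝ)} (hS : ZariskiDense S) :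
    S.Nonempty := by
  by_contra h
  rw [Set.not_nonempty_iff_eq_empty] at h
  exact one_ne_zero (hS 1 (by simp [h]))

/-- In a finite colouring of a Zariski dense set, some colour class is Zariski dense. -/
theorem ZariskiDense.exists_fiber {n : ℕ} {S : Set (Fin n → ℝ)} (hS : ZariskiDense S)
    {ι : Type*} [Finite ι] (c : (Fin n → ℝ) → ι) :
    ∃ a, ZariskiDense {x ∈ S | c x = a} := by
  have := Fintype.ofFinite ι
  by_contra! h
  simp only [ZariskiDense, not_forall] at h
  choose p hp hp0 using h
  refine Finset.prod_ne_zero_iff.2 (fun a _ => hp0 a) (hS (∏ a, p a) fun x hx => ?_)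
  rw [map_prod]
  exact Finset.prod_eq_zero (Finset.mem_univ (c x)) (hp (c x) x ⟨hx, rfl⟩)

/-- Given finitely many families of subspaces indexed by points, one can pick `j` points and a
Zariski dense set of further points such that for each family, the span of the chosen subspaces
either has dimension at least `j` or contains all the further subspaces. -/
theorem exists_saturated_points {n : ℕ} {ι E : Type*} [Finite ι] [AddCommGroup E] [Module ℝ E]
    [FiniteDimensional ℝ E] (W : (Fin n → ℝ) → ι → Submodule ℝ E) (j : ℕ) :
    ∃ (T : Fin j → (Fin n → ℝ)) (S : Set (Fin n → ℝ)), ZariskiDense S ∧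
      ∀ i, (∀ s ∈ S, W s i ≤ ⨆ t, W (T t) i) ∨
        j ≤ Module.finrank ℝ (⨆ t, W (T t) i : Submodule ℝ E) := by
  induction j with
  | zero => exact ⟨Fin.elim0, Set.univ, zariskiDense_univ n, fun i => Or.inr (Nat.zero_le _)⟩
  | succ j ih =>
    obtain ⟨T, S, hS, hT⟩ := ih
    obtain ⟨τ, hτ⟩ := hS.exists_fiber fun s => {i | W s i ≤ ⨆ t, W (T t) i}
    obtain ⟨s, hsS, hs⟩ := hτ.nonempty
    have hsup : ∀ i, (⨆ t, W ((Fin.cons s T : Fin (j + 1) → (Fin n → ℝ)) t) i) =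
        W s i ⊔ ⨆ t, W (T t) i := by
      intro i
      apply le_antisymm
      · refine iSup_le fun t => ?_
        refine Fin.cases ?_ (fun t => ?_) t
        · exact le_sup_left
        · exact le_sup_of_le_right (le_iSup (fun t => W (T t) i) t)
      · refine sup_le ?_ (iSup_le fun t => ?_)
        · exact le_iSup_of_le 0 le_rfl
        · exact le_iSup_of_le t.succ le_rfl
    refine ⟨Fin.cons s T, _, hτ, fun i => ?_⟩
    rw [hsup]
    by_cases hi : i ∈ τ
    · left
      rintro s' ⟨-, hs'⟩
      have : i ∈ {i | W s' i ≤ ⨆ t, W (T t) i} := hs' ▸ hi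
      exact le_sup_of_le_right this
    · right
      have hnot : ¬ W s i ≤ ⨆ t, W (T t) i := fun h => hi (hs ▸ h)
      have hj := (hT i).resolve_left fun h => hnot (h s hsS)
      have := Submodule.finrank_lt_finrank_of_lt (right_lt_sup.2 hnot)
      omega

/-- There are `C(n+d,n)` monomials of degree at most `d` in `n` variables. -/
theorem card_monIdx (n d : ℕ) : Fintype.card (MonIdx n d) = Nat.choose (n + d) n := by
  let e : MonIdx n d ≃ {P : Fin (n + 1) → ℕ // ∑ i, P i = d} :=
    { toFun := fun a => ⟨Fin.cons (d - ∑ i, (a.1 i : ℕ)) fun i => (a.1 i : ℕ), by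
        have := a.2
        rw [Fin.sum_univ_succ]
        simp only [Fin.cons_zero, Fin.cons_succ]
        omega⟩
      invFun := fun P => by
        have hP : P.1 0 + ∑ i : Fin n, P.1 i.succ = d := by rw [← Fin.sum_univ_succ, P.2]
        exact ⟨fun i => ⟨P.1 i.succ, by
          have := Finset.single_le_sum (f := fun i : Fin n => P.1 i.succ)
            (fun i _ => Nat.zero_le _) (Finset.mem_univ i)
          omega⟩, by simp only; omega⟩
      left_inv := fun a => by
        apply Subtype.ext
        funext i
        simp
      right_inv := fun P => by
        have hP : P.1 0 + ∑ i : Fin n, P.1 i.succ = d := by rw [← Fin.sum_univ_succ, P.2]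
        apply Subtype.ext
        funext i
        refine Fin.cases ?_ (fun i => ?_) i
        · simp only [Fin.cons_zero]
          omega
        · simp }
  rw [Fintype.card_congr (e.trans (Sym.equivNatSumOfFintype (Fin (n + 1)) d).symm),
    Sym.card_sym_eq_choose, Fintype.card_fin, show n + 1 + d - 1 = n + d by omega,
    Nat.choose_symm_add]

/-- The exponent vector of a monomial index. -/
noncomputable def MonIdx.exponent {n d : ℕ} (a : MonIdx n d) : Fin n →₀ ℕ :=
  Finsupp.equivFunOnFinite.symm fun i => (a.1 i : ℕ)

theorem MonIdx.exponent_injective {n d : ℕ} :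
    Function.Injective (MonIdx.exponent : MonIdx n d → (Fin n →₀ ℕ)) := by
  intro a b h
  apply Subtype.ext
  funext i
  exact Fin.ext (DFunLike.congr_fun h i)

theorem MonIdx.degree_exponent {n d : ℕ} (a : MonIdx n d) : a.exponent.degree ≤ d := by
  rw [Finsupp.degree_eq_sum]
  exact a.2

theorem MonIdx.exists_exponent_eq {n d : ℕ} {s : Fin n →₀ ℕ} (hs : s.degree ≤ d) :
    ∃ a : MonIdx n d, a.exponent = s := by
  rw [Finsupp.degree_eq_sum] at hs
  refine ⟨⟨fun i => ⟨s i, ?_⟩, hs⟩, ?_⟩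
  · have := Finset.single_le_sum (f := s) (fun i _ => Nat.zero_le _) (Finset.mem_univ i)
    omega
  · ext i
    rfl

/-- The polynomial with coefficients `c` at the monomials of degree at most `d`. -/
noncomputable def polyOfCoeffs (n d : ℕ) : (MonIdx n d → ℝ) →ₗ[ℝ] MvPolynomial (Fin n) ℝ :=
  ∑ a, (monomial a.exponent).comp (LinearMap.proj a)

theorem polyOfCoeffs_apply {n d : ℕ} (c : MonIdx n d → ℝ) :
    polyOfCoeffs n d c = ∑ a, monomial a.exponent (c a) := by
  simp [polyOfCoeffs]

theorem coeff_polyOfCoeffs {n d : ℕ} (c : MonIdx n d → ℝ) (a : MonIdx n d) :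
    coeff a.exponent (polyOfCoeffs n d c) = c a := by
  rw [polyOfCoeffs_apply, coeff_sum, Finset.sum_eq_single a]
  · simp
  · intro b _ hb
    rw [coeff_monomial, if_neg fun h => hb (MonIdx.exponent_injective h)]
  · simp

theorem polyOfCoeffs_injective (n d : ℕ) : Function.Injective (polyOfCoeffs n d) := by
  intro c c' h
  funext a
  rw [← coeff_polyOfCoeffs c a, h, coeff_polyOfCoeffs]

theorem totalDegree_polyOfCoeffs {n d : ℕ} (c : MonIdx n d → ℝ) :
    (polyOfCoeffs n d c).totalDegree ≤ d := by
  rw [polyOfCoeffs_apply]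
  refine totalDegree_finsetSum_le fun a _ => (totalDegree_monomial_le _ _).trans ?_
  exact a.degree_exponent

theorem polyOfCoeffs_coeff {n d : ℕ} {g : MvPolynomial (Fin n) ℝ} (hg : g.totalDegree ≤ d) :
    polyOfCoeffs n d (fun a => coeff a.exponent g) = g := by
  ext s
  by_cases hs : s.degree ≤ d
  · obtain ⟨a, rfl⟩ := MonIdx.exists_exponent_eq hs
    exact coeff_polyOfCoeffs _ a
  · rw [polyOfCoeffs_apply, coeff_sum, Finset.sum_eq_zero,
      coeff_eq_zero_of_totalDegree_lt (lt_of_le_of_lt hg _)]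
    · exact not_le.1 hs
    · intro a _
      rw [coeff_monomial, if_neg]
      rintro rfl
      exact hs a.degree_exponent

/-- The summands of a sum of squares of degree at most `2 * d` have degree at most `d`. -/
theorem totalDegree_le_of_sum_sq {n d r : ℕ} (g : Fin r → MvPolynomial (Fin n) ℝ)
    (h : (∑ i, g i ^ 2).totalDegree ≤ 2 * d) (i : Fin r) : (g i).totalDegree ≤ d := by
  obtain ⟨j, -, hj⟩ := Finset.exists_max_image Finset.univ
    (fun i => MonomialOrder.degLex.toSyn (MonomialOrder.degLex.degree (g i)))
    ⟨i, Finset.mem_univ i⟩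
  refine (MvPolynomial.degLex_totalDegree_monotone (hj i (Finset.mem_univ i))).trans ?_
  by_cases hgj : g j = 0
  · simp [hgj]
  set μ := MonomialOrder.degLex.degree (g j) with hμ
  have hcoeff : coeff (μ + μ) (∑ i, g i ^ 2) = ∑ i, coeff μ (g i) ^ 2 := by
    rw [coeff_sum]
    refine Finset.sum_congr rfl fun i _ => ?_
    rw [sq, sq, MonomialOrder.degLex.coeff_mul_of_add_of_degree_le (hj i (Finset.mem_univ i))
      (hj i (Finset.mem_univ i))]
  have hpos : 0 < ∑ i, coeff μ (g i) ^ 2 := by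
    refine Finset.sum_pos' (fun _ _ => sq_nonneg _) ⟨j, Finset.mem_univ j, ?_⟩
    have : coeff μ (g j) ≠ 0 := MonomialOrder.degLex.coeff_degree_ne_zero_iff.2 hgj
    positivity
  have hmem : μ + μ ∈ (∑ i, g i ^ 2).support := by
    rw [mem_support_iff, hcoeff]
    exact hpos.ne'
  have hdeg : (μ + μ).degree ≤ 2 * d := (le_totalDegree hmem).trans h
  rw [map_add, hμ, MvPolynomial.degree_degLexDegree] at hdeg
  omega

/-- The linear map sending a matrix `A` to the polynomial `vᵀ A v`, with `v` the vector of
monomials of degree at most `d`. -/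
noncomputable def gramMap (n d : ℕ) :
    Matrix (MonIdx n d) (MonIdx n d) ℝ →ₗ[ℝ] MvPolynomial (Fin n) ℝ where
  toFun A := ∑ a : MonIdx n d, ∑ b : MonIdx n d,
    C (A a b) * ∏ i, X i ^ ((a.1 i : ℕ) + (b.1 i : ℕ))
  map_add' A B := by simp [add_mul, Finset.sum_add_distrib]
  map_smul' c A := by simp [Finset.smul_sum, MvPolynomial.smul_eq_C_mul, mul_assoc]

theorem gramMap_apply {n d : ℕ} (A : Matrix (MonIdx n d) (MonIdx n d) ℝ) :
    gramMap n d A = ∑ a : MonIdx n d, ∑ b : MonIdx n d,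
      C (A a b) * ∏ i, X i ^ ((a.1 i : ℕ) + (b.1 i : ℕ)) := rfl

theorem gramMap_transpose_mul_self {n d : ℕ} {κ : Type*} [Fintype κ]
    (B : Matrix κ (MonIdx n d) ℝ) :
    gramMap n d (B.transpose * B) = ∑ l, polyOfCoeffs n d (B l) ^ 2 := by
  have hsq : ∀ l, polyOfCoeffs n d (B l) ^ 2 = ∑ a : MonIdx n d, ∑ b : MonIdx n d,
      C (B l a * B l b) * ∏ i, X i ^ ((a.1 i : ℕ) + (b.1 i : ℕ)) := by
    intro l
    rw [polyOfCoeffs_apply, sq, Finset.sum_mul_sum]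
    refine Finset.sum_congr rfl fun a _ => Finset.sum_congr rfl fun b _ => ?_
    rw [monomial_mul, monomial_eq, Finsupp.prod_fintype _ _ (by simp)]
    rfl
  simp only [hsq]
  symm
  rw [Finset.sum_comm, gramMap_apply]
  refine Finset.sum_congr rfl fun a _ => ?_
  rw [Finset.sum_comm]
  refine Finset.sum_congr rfl fun b _ => ?_
  simp [Matrix.mul_apply, map_sum, Finset.sum_mul]

theorem sosCone_eq_image_gramMap (n d : ℕ) :
    SOSCone n d = gramMap n d '' {A | A.PosSemidef} := by
  ext f
  constructor
  · rintro ⟨hf, r, g, rfl⟩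
    refine ⟨_, ?_, (gramMap_transpose_mul_self
      (Matrix.of fun i a => coeff a.exponent (g i))).trans ?_⟩
    · exact Matrix.posSemidef_conjTranspose_mul_self _
    · exact Finset.sum_congr rfl fun i _ =>
        congrArg (· ^ 2) (polyOfCoeffs_coeff (totalDegree_le_of_sum_sq g hf i))
  · rintro ⟨A, hA, rfl⟩
    open scoped MatrixOrder in
    obtain ⟨B, rfl⟩ := CStarAlgebra.nonneg_iff_eq_star_mul_self.mp
      (Matrix.PosSemidef.nonneg hA)
    have hB := gramMap_transpose_mul_self B
    rw [Matrix.star_eq_conjTranspose, Matrix.conjTranspose_eq_transpose_of_trivial, hB]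
    refine ⟨totalDegree_finsetSum_le fun l _ => (totalDegree_pow _ _).trans ?_,
      Fintype.card (MonIdx n d), fun j => polyOfCoeffs n d (B ((Fintype.equivFin _).symm j)), ?_⟩
    · exact Nat.mul_le_mul_left 2 (totalDegree_polyOfCoeffs _)
    · exact ((Fintype.equivFin _).symm.sum_comp fun l => polyOfCoeffs n d (B l) ^ 2).symm

theorem hasLift_psdCone_sosCone (n d : ℕ) :
    HasLift (PSDCone (Nat.choose (n + d) n)) (SOSCone n d) := by
  rw [← card_monIdx]
  let e := Fintype.equivFin (MonIdx n d)
  refine ⟨⊤, (gramMap n d).comp (Matrix.reindexLinearEquiv ℝ ℝ e.symm e.symm).toLinearMap, ?_⟩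
  rw [sosCone_eq_image_gramMap, AffineSubspace.top_coe, Set.inter_univ]
  ext f
  constructor
  · rintro ⟨A, hA, rfl⟩
    refine ⟨A.submatrix e.symm e.symm, hA.submatrix _, ?_⟩
    simp [Matrix.submatrix_submatrix]
  · rintro ⟨A, hA, rfl⟩
    exact ⟨A.submatrix e e, hA.submatrix _, by simp⟩

theorem HasLift.psdTuple {V : Type*} [AddCommGroup V] [Module ℝ V] {S : Set V} {k : ℕ}
    (h : HasLift (PSDCone k) S) : HasLift (PSDTuple k 1) S := by
  obtain ⟨H, p, rfl⟩ := h
  let q : (Fin 1 → Matrix (Fin k) (Fin k) ℝ) →ₗ[ℝ] Matrix (Fin k) (Fin k) ℝ := LinearMap.proj 0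
  refine ⟨H.comap q.toAffineMap, p.comp q, ?_⟩
  ext f
  constructor
  · rintro ⟨A, ⟨hA, hAH⟩, rfl⟩
    exact ⟨fun _ => A, ⟨fun _ => hA, hAH⟩, rfl⟩
  · rintro ⟨A, ⟨hA, hAH⟩, rfl⟩
    exact ⟨A 0, ⟨hA 0, hAH⟩, rfl⟩

theorem not_hasLift_psdTuple_sosCone {n d k m : ℕ} (hk : k < Nat.choose (n + d) n) :
    ¬ HasLift (PSDTuple k m) (SOSCone n d) := by
  rintro ⟨H, p, hp⟩
  have himage : ∀ A ∈ PSDTuple k m ∩ H, p A ∈ SOSCone n d := fun A hA => hp ▸ ⟨A, hA, rfl⟩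
  let L : (Fin n → ℝ) → (Fin m → Matrix (Fin k) (Fin k) ℝ) →ₗ[ℝ] ℝ :=
    fun x => (aeval x).toLinearMap.comp p
  have hLapply : ∀ x A, L x A = eval x (p A) := fun x A => by simp [L, aeval_eq_eval]
  have hL : ∀ x, ∀ A ∈ PSDTuple k m ∩ H, 0 ≤ L x A := by
    intro x A hA
    obtain ⟨-, r, g, hg⟩ := himage A hA
    rw [hLapply, hg, map_sum]
    exact Finset.sum_nonneg fun i _ => by rw [map_pow]; exact sq_nonneg _
  have hzero : (0 : MvPolynomial (Fin n) ℝ) ∈ SOSCone n d := ⟨by simp, 0, Fin.elim0, by simp⟩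
  have hconv : ∀ x, Convex ℝ {A | A ∈ PSDTuple k m ∩ H ∧ L x A = 0} := by
    rintro x A ⟨⟨hA, hAH⟩, hA0⟩ B ⟨⟨hB, hBH⟩, hB0⟩ s t hs ht hst
    refine ⟨⟨fun i => ((hA i).smul hs).add ((hB i).smul ht), H.convex hAH hBH hs ht hst⟩, ?_⟩
    simp [hA0, hB0]
  have hne : ∀ x, {A | A ∈ PSDTuple k m ∩ H ∧ L x A = 0}.Nonempty := by
    intro x
    rw [hp] at hzero
    obtain ⟨A, hA, hA0⟩ := hzero
    exact ⟨A, hA, by rw [hLapply, hA0, map_zero]⟩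
  choose A₀ hA₀ hmin using fun x =>
    exists_forall_ker_le (fun A hA => hA.1.1) (hconv x) (hne x)
  obtain ⟨T, S, hS, hT⟩ :=
    exists_saturated_points (fun x i => LinearMap.ker (A₀ x i).mulVecLin) k
  obtain ⟨c, hc, hc0⟩ : ∃ c : MonIdx n d → ℝ,
      (∀ t, eval (T t) (polyOfCoeffs n d c) = 0) ∧ c ≠ 0 := by
    let E : (MonIdx n d → ℝ) →ₗ[ℝ] (Fin k → ℝ) :=
      LinearMap.pi fun t => (aeval (T t)).toLinearMap.comp (polyOfCoeffs n d)
    have hE : LinearMap.ker E ≠ ⊥ := LinearMap.ker_ne_bot_of_finrank_lt (by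
      rw [Module.finrank_fin_fun, Module.finrank_fintype_fun_eq_card, card_monIdx]
      exact hk)
    obtain ⟨c, hc, hc0⟩ := Submodule.exists_mem_ne_zero_of_ne_bot hE
    refine ⟨c, fun t => ?_, hc0⟩
    simpa [E, aeval_eq_eval] using congrFun (LinearMap.mem_ker.1 hc) t
  set g := polyOfCoeffs n d c with hg
  have hg0 : g ≠ 0 := fun h => hc0 (polyOfCoeffs_injective n d (by rw [map_zero, ← hg, h]))
  obtain ⟨s, hsS, hgs⟩ : ∃ s ∈ S, eval s g ≠ 0 := by
    by_contra! h
    exact hg0 (hS g h)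
  have hgmem : g ^ 2 ∈ SOSCone n d :=
    ⟨(totalDegree_pow _ _).trans (Nat.mul_le_mul_left 2 (totalDegree_polyOfCoeffs c)),
      1, fun _ => g, by simp⟩
  rw [hp] at hgmem
  obtain ⟨A, hA, hAg⟩ := hgmem
  have hker : ∀ i, (⨆ t, LinearMap.ker (A₀ (T t) i).mulVecLin) ≤
      LinearMap.ker (A i).mulVecLin := fun i => iSup_le fun t =>
    hmin (T t) A ⟨hA, by rw [hLapply, hAg, map_pow, hc]; simp⟩ i
  have hs0 : L s A = 0 := by
    refine eval_eq_zero_of_ker_le H (L s) (hL s) (hA₀ s).1 hA (hA₀ s).2 fun i => ?_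
    rcases hT i with h | h
    · exact (h s hsS).trans (hker i)
    · have htop : (⨆ t, LinearMap.ker (A₀ (T t) i).mulVecLin) = ⊤ :=
        Submodule.eq_top_of_finrank_eq (le_antisymm (Submodule.finrank_le _) (by simpa using h))
      exact le_top.trans (htop ▸ hker i)
  rw [hLapply, hAg, map_pow] at hs0
  exact hgs (pow_eq_zero_iff two_ne_zero |>.1 hs0)

/-- Corollary 2.3: `sxdeg(Σ_{n,2d}) = sxc(Σ_{n,2d}) = C(n+d,n)`; concretely, `Σ_{n,2d}` has an
`𝒮₊ᵏ`-lift with `k = C(n+d,n)` — namely `Σ_{n,2d} = {v_{n,d}ᵀ A v_{n,d} : A ∈ 𝒮₊ᵏ}` where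
`v_{n,d}` is the vector of all monomials of degree at most `d` — and `Σ_{n,2d}` has no
`(𝒮₊ᵏ)^m`-lift for any `m` when `k < C(n+d,n)`. -/
theorem stmt_2 (n d : ℕ) (hn : 1 ≤ n) (hd : 1 ≤ d) :
    sxdeg (SOSCone n d) = (Nat.choose (n + d) n : ℕ∞) ∧
    sxc (SOSCone n d) = (Nat.choose (n + d) n : ℕ∞) ∧
    HasLift (PSDCone (Nat.choose (n + d) n)) (SOSCone n d) ∧
    SOSCone n d = {f | ∃ A : Matrix (MonIdx n d) (MonIdx n d) ℝ, A.PosSemidef ∧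
      f = ∑ a : MonIdx n d, ∑ b : MonIdx n d,
        MvPolynomial.C (A a b) * ∏ i, MvPolynomial.X i ^ ((a.1 i : ℕ) + (b.1 i : ℕ))} ∧
    ∀ k m : ℕ, k < Nat.choose (n + d) n → ¬ HasLift (PSDTuple k m) (SOSCone n d) := by
  have hlift := hasLift_psdCone_sosCone n d
  have hno : ∀ k m : ℕ, k < Nat.choose (n + d) n → ¬ HasLift (PSDTuple k m) (SOSCone n d) :=
    fun k m hk => not_hasLift_psdTuple_sosCone hk
  refine ⟨le_antisymm (sInf_le ⟨_, 1, rfl, hlift.psdTuple⟩) (le_sInf ?_),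
    le_antisymm (sInf_le ⟨_, rfl, hlift⟩) (le_sInf ?_), hlift, ?_, hno⟩
  · rintro _ ⟨k, m, rfl, hk⟩
    exact Nat.cast_le.2 (not_lt.1 fun h => hno k m h hk)
  · rintro _ ⟨k, rfl, hk⟩
    exact Nat.cast_le.2 (not_lt.1 fun h => hno k 1 h hk.psdTuple)
  · rw [sosCone_eq_image_gramMap]
    ext f
    exact ⟨fun ⟨A, hA, h⟩ => ⟨A, hA, h.symm⟩, fun ⟨A, hA, h⟩ => ⟨A, hA, h.symm⟩⟩
end

section
/- For every k ∈ ℕ, sxdeg(𝒮₊ᵏ) = k; that is, the cone 𝒮₊ᵏ of k×k symmetric positive semidefinite matrices has no ((𝒮₊ʲ)^m)-lift for any j < k and any m ∈ ℕ, while it trivially has a 𝒮₊ᵏ-lift. -/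
open MvPolynomial

open scoped Topology MatrixOrder

/-- A positive semidefinite matrix `B` is dominated by a multiple of any positive semidefinite
matrix `A` whose kernel is contained in that of `B`. -/
theorem Matrix.PosSemidef.eventually_sub_smul {n : Type*} [Fintype n] [DecidableEq n]
    {A B : Matrix n n ℝ} (hA : A.PosSemidef) (hB : B.PosSemidef)
    (h : LinearMap.ker A.mulVecLin ≤ LinearMap.ker B.mulVecLin) :
    ∀ᶠ c : ℝ in 𝓝[>] 0, (A - c • B).PosSemidef := by
  obtain ⟨C, hC⟩ := CStarAlgebra.nonneg_iff_eq_star_mul_self.mp hA.nonneg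
  obtain ⟨D, hD⟩ := CStarAlgebra.nonneg_iff_eq_star_mul_self.mp hB.nonneg
  have hqA (x : n → ℝ) : x ⬝ᵥ (A.mulVec x) = (C.mulVec x) ⬝ᵥ (C.mulVec x) := by
    rw [hC, ← Matrix.mulVec_mulVec, Matrix.dotProduct_mulVec, Matrix.star_eq_conjTranspose,
      Matrix.conjTranspose_eq_transpose_of_trivial, Matrix.vecMul_transpose]
  have hqB (x : n → ℝ) : x ⬝ᵥ (B.mulVec x) = (D.mulVec x) ⬝ᵥ (D.mulVec x) := by
    rw [hD, ← Matrix.mulVec_mulVec, Matrix.dotProduct_mulVec, Matrix.star_eq_conjTranspose,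
      Matrix.conjTranspose_eq_transpose_of_trivial, Matrix.vecMul_transpose]
  have hker : LinearMap.ker C.mulVecLin ≤ LinearMap.ker D.mulVecLin := by
    intro x hx
    have hx' : A.mulVecLin x = 0 := by
      have : C.mulVec x = 0 := hx
      rw [Matrix.mulVecLin_apply, hC, ← Matrix.mulVec_mulVec, this, Matrix.mulVec_zero]
    have hBx : B.mulVec x = 0 := h hx'
    have : (D.mulVec x) ⬝ᵥ (D.mulVec x) = 0 := by rw [← hqB, hBx, dotProduct_zero]
    exact dotProduct_self_eq_zero.mp this
  obtain ⟨E, hE⟩ := LinearMap.exists_extend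
    ((LinearMap.ker C.mulVecLin).liftQ D.mulVecLin hker ∘ₗ
      C.mulVecLin.quotKerEquivRange.symm.toLinearMap)
  have hEC (x : n → ℝ) : D.mulVec x = E.toMatrix'.mulVec (C.mulVec x) := by
    have := LinearMap.congr_fun hE ⟨C.mulVecLin x, LinearMap.mem_range_self _ x⟩
    rw [LinearMap.toMatrix'_mulVec]
    have hsymm : C.mulVecLin.quotKerEquivRange.symm
        ⟨C.mulVecLin x, LinearMap.mem_range_self _ x⟩ = Submodule.Quotient.mk x :=
      C.mulVecLin.quotKerEquivRange_symm_apply_image x _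
    rw [LinearMap.comp_apply, LinearMap.comp_apply, LinearEquiv.coe_coe, hsymm,
      Submodule.liftQ_apply] at this
    exact this.symm
  set K : ℝ := ∑ i, ∑ j, E.toMatrix' i j ^ 2
  have hK : 0 ≤ K := by positivity
  have hbound (y : n → ℝ) :
      (E.toMatrix'.mulVec y) ⬝ᵥ (E.toMatrix'.mulVec y) ≤ K * (y ⬝ᵥ y) := by
    have hy : y ⬝ᵥ y = ∑ j, y j ^ 2 := Finset.sum_congr rfl fun _ _ => (sq _).symm
    rw [hy, Finset.sum_mul]
    refine Finset.sum_le_sum fun i _ => ?_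
    rw [← sq]
    exact Finset.sum_mul_sq_le_sq_mul_sq _ _ _
  filter_upwards [Ioo_mem_nhdsGT (show (0 : ℝ) < 1 / (K + 1) by positivity)] with c hc
  have hcK : c * (K + 1) < 1 := (lt_div_iff₀ (by positivity)).mp hc.2
  refine .of_dotProduct_mulVec_nonneg (hA.1.sub (hB.1.smul (.all c))) fun x => ?_
  rw [star_trivial, Matrix.sub_mulVec, dotProduct_sub, Matrix.smul_mulVec, dotProduct_smul,
    hqA, hqB, hEC, smul_eq_mul]
  have h1 := mul_le_mul_of_nonneg_left (hbound (C.mulVec x)) hc.1.le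
  have h2 : 0 ≤ (C.mulVec x) ⬝ᵥ (C.mulVec x) := by
    simpa using dotProduct_star_self_nonneg (C.mulVec x)
  nlinarith [hc.1]

theorem Matrix.PosSemidef.ker_add {n : Type*} [Fintype n] {A B : Matrix n n ℝ}
    (hA : A.PosSemidef) (hB : B.PosSemidef) :
    LinearMap.ker (A + B).mulVecLin = LinearMap.ker A.mulVecLin ⊓ LinearMap.ker B.mulVecLin := by
  refine le_antisymm (fun x hx => ?_) fun x ⟨h1, h2⟩ => ?_
  · have hx' : (A + B).mulVec x = 0 := hx
    have hsum : star x ⬝ᵥ A.mulVec x + star x ⬝ᵥ B.mulVec x = 0 := by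
      rw [← dotProduct_add, ← Matrix.add_mulVec, hx', dotProduct_zero]
    have hA0 := hA.dotProduct_mulVec_nonneg x
    have hB0 := hB.dotProduct_mulVec_nonneg x
    exact ⟨(hA.dotProduct_mulVec_zero_iff x).mp (by linarith),
      (hB.dotProduct_mulVec_zero_iff x).mp (by linarith)⟩
  · have h1' : A.mulVec x = 0 := h1
    have h2' : B.mulVec x = 0 := h2
    rw [LinearMap.mem_ker, Matrix.mulVecLin_apply, Matrix.add_mulVec, h1', h2', add_zero]

theorem Matrix.PosSemidef.ker_sum_le {n ι : Type*} [Fintype n] {s : Finset ι}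
    {A : ι → Matrix n n ℝ} (hA : ∀ i ∈ s, (A i).PosSemidef) :
    LinearMap.ker (∑ i ∈ s, A i).mulVecLin ≤ s.inf fun i => LinearMap.ker (A i).mulVecLin := by
  classical
  induction s using Finset.induction_on with
  | empty => simp
  | insert i s hi ih =>
    have hs : ∀ i ∈ s, (A i).PosSemidef := fun l hl => hA l (Finset.mem_insert_of_mem hl)
    rw [Finset.sum_insert hi, Finset.inf_insert,
      (hA i (Finset.mem_insert_self _ _)).ker_add (Matrix.posSemidef_sum s hs)]
    exact inf_le_inf le_rfl (ih hs)

/-- Given finitely many sequences of subspaces of a space of dimension at most `j`, there are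
`j` indices and a further index whose members contain the intersection of the members at the
chosen `j` indices, simultaneously for all the sequences. -/
theorem exists_finset_inf_le {E : Type*} [AddCommGroup E] [Module ℝ E] [FiniteDimensional ℝ E]
    {τ : Type*} [Finite τ] (L : ℕ → τ → Submodule ℝ E) (j : ℕ) (hj : Module.finrank ℝ E ≤ j) :
    ∃ (I : Finset ℕ) (i : ℕ), I.card = j ∧ i ∉ I ∧ ∀ t, (I.inf fun l => L l t) ≤ L i t := by
  have hmem (I : Finset ℕ) : ∀ᶠ i in (Filter.hyperfilter ℕ : Filter ℕ), i ∉ I :=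
    Filter.hyperfilter_le_cofinite I.finite_toSet.compl_mem_cofinite
  have key (n : ℕ) : ∃ I : Finset ℕ, I.card = n ∧ ∀ t,
      (∀ᶠ i in (Filter.hyperfilter ℕ : Filter ℕ), (I.inf fun l => L l t) ≤ L i t) ∨
        Module.finrank ℝ ↥(I.inf fun l => L l t) + n ≤ j := by
    induction n with
    | zero => exact ⟨∅, rfl, fun t => .inr ((Submodule.finrank_le _).trans hj)⟩
    | succ n ih =>
      obtain ⟨I, hI, h⟩ := ih
      have hev : ∀ᶠ i in (Filter.hyperfilter ℕ : Filter ℕ), ∀ t,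
          (∀ᶠ i in (Filter.hyperfilter ℕ : Filter ℕ), (I.inf fun l => L l t) ≤ L i t) ∨
            ¬ (I.inf fun l => L l t) ≤ L i t := by
        refine Filter.eventually_all.mpr fun t => ?_
        by_cases ht : ∀ᶠ i in (Filter.hyperfilter ℕ : Filter ℕ), (I.inf fun l => L l t) ≤ L i t
        · exact .of_forall fun _ => .inl ht
        · exact (Ultrafilter.eventually_not.mpr ht).mono fun _ => .inr
      obtain ⟨i, hi, hiI⟩ := (hev.and (hmem I)).exists
      refine ⟨insert i I, by rw [Finset.card_insert_of_notMem hiI, hI], fun t => ?_⟩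
      have hle : ((insert i I).inf fun l => L l t) ≤ I.inf fun l => L l t :=
        Finset.inf_mono (Finset.subset_insert _ _)
      by_cases ht : ∀ᶠ i in (Filter.hyperfilter ℕ : Filter ℕ), (I.inf fun l => L l t) ≤ L i t
      · exact .inl (ht.mono fun _ => hle.trans)
      · right
        have hlt : ((insert i I).inf fun l => L l t) < I.inf fun l => L l t := by
          refine lt_of_le_of_ne hle fun heq => ((hi t).resolve_left ht) ?_
          rw [← heq]
          exact Finset.inf_le (Finset.mem_insert_self _ _)
        have := Submodule.finrank_lt_finrank_of_lt hlt
        have := (h t).resolve_left ht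
        omega
  obtain ⟨I, hI, h⟩ := key j
  have hev : ∀ᶠ i in (Filter.hyperfilter ℕ : Filter ℕ), ∀ t,
      (I.inf fun l => L l t) ≤ L i t := by
    refine Filter.eventually_all.mpr fun t => (h t).elim id fun ht => ?_
    have hbot : (I.inf fun l => L l t) = ⊥ := Submodule.finrank_eq_zero.mp (by omega)
    exact .of_forall fun i => hbot ▸ bot_le
  obtain ⟨i, hi, hiI⟩ := (hev.and (hmem I)).exists
  exact ⟨I, i, hI, hiI, hi⟩

/-- The points `(1, i, …, i ^ (k - 1))` of the moment curve: fewer than `k` of them lie on a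
hyperplane through the origin that avoids all the others. -/
theorem exists_dotProduct_momentCurve {k : ℕ} (I : Finset ℕ) (hI : I.card < k) :
    ∃ w : Fin k → ℝ, ∀ i : ℕ, (w ⬝ᵥ fun r : Fin k => (i : ℝ) ^ (r : ℕ)) = 0 ↔ i ∈ I := by
  set P : Polynomial ℝ := ∏ l ∈ I, (Polynomial.X - Polynomial.C (l : ℝ)) with hP
  have hdeg : P.natDegree < k := by rwa [hP, Polynomial.natDegree_finsetProd_X_sub_C_eq_card]
  refine ⟨fun r => P.coeff r, fun i => ?_⟩
  have heval : ((fun r : Fin k => P.coeff r) ⬝ᵥ fun r : Fin k => (i : ℝ) ^ (r : ℕ)) =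
      P.eval (i : ℝ) := by
    rw [Polynomial.eval_eq_sum_range' hdeg, Finset.sum_range]
    rfl
  rw [heval, hP, Polynomial.eval_prod, Finset.prod_eq_zero_iff]
  simp [sub_eq_zero]

theorem dotProduct_vecMulVec_mulVec_self {n : Type*} [Fintype n] (w v : n → ℝ) :
    w ⬝ᵥ (Matrix.vecMulVec v v).mulVec w = (w ⬝ᵥ v) ^ 2 := by
  rw [Matrix.vecMulVec_mulVec, dotProduct_smul, dotProduct_comm v w]
  simp [sq]

theorem not_hasLift_psdTuple_psdCone {j k : ℕ} (m : ℕ) (hjk : j < k) :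
    ¬ HasLift (PSDTuple j m) (PSDCone k) := by
  rintro ⟨H, p, hp⟩
  let v (i : ℕ) : Fin k → ℝ := fun r => (i : ℝ) ^ (r : ℕ)
  have hlift (X : Matrix (Fin k) (Fin k) ℝ) (hX : X.PosSemidef) :
      ∃ a, a ∈ PSDTuple j m ∧ a ∈ H ∧ p a = X := by
    have : X ∈ p '' (PSDTuple j m ∩ (H : Set _)) := hp ▸ hX
    obtain ⟨a, ⟨h1, h2⟩, h3⟩ := this
    exact ⟨a, h1, h2, h3⟩
  obtain ⟨b, hb, hbH, hpb⟩ := hlift 0 .zero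
  choose a ha haH hpa using fun i =>
    hlift (Matrix.vecMulVec (v i) (v i)) (by
      simpa using Matrix.posSemidef_vecMulVec_self_star (v i))
  obtain ⟨I, i, hI, hiI, hle⟩ := exists_finset_inf_le
    (fun i t => LinearMap.ker (a i t).mulVecLin) j (by simp)
  have hsum (t : Fin m) : (∑ l ∈ I, a l t).PosSemidef :=
    Matrix.posSemidef_sum I fun l _ => ha l t
  have hdom : ∀ᶠ c : ℝ in 𝓝[>] 0, ∀ t, ((b t + ∑ l ∈ I, a l t) - c • a i t).PosSemidef := by
    refine Filter.eventually_all.mpr fun t => ((hb t).add (hsum t)).eventually_sub_smul (ha i t) ?_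
    rw [(hb t).ker_add (hsum t)]
    exact inf_le_right.trans ((Matrix.PosSemidef.ker_sum_le fun l _ => ha l t).trans (hle t))
  obtain ⟨c, hc, (hc0 : 0 < c)⟩ := (hdom.and self_mem_nhdsWithin).exists
  set δ : ℝ := 1 / (j + 1) with hδ
  have hδ0 : 0 < δ := by positivity
  have hδj : 1 - j * δ = δ := by rw [hδ]; field_simp; ring
  let d : Fin m → Matrix (Fin j) (Fin j) ℝ := δ • ∑ l ∈ I, (a l - b) - (δ * c) • (a i - b)
  have hdH : d + b ∈ H := by
    refine AffineSubspace.vadd_mem_of_mem_direction (Submodule.sub_mem _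
      (Submodule.smul_mem _ _ (Submodule.sum_mem _ fun l _ => ?_)) (Submodule.smul_mem _ _ ?_)) hbH
    exacts [AffineSubspace.vsub_mem_direction (haH l) hbH,
      AffineSubspace.vsub_mem_direction (haH i) hbH]
  have hdb : d + b = δ • ((b + ∑ l ∈ I, a l) - c • a i) + (δ * c) • b := by
    have hsub : ∑ l ∈ I, (a l - b) = ∑ l ∈ I, a l - (j : ℝ) • b := by
      rw [Finset.sum_sub_distrib, Finset.sum_const, hI, Nat.cast_smul_eq_nsmul]
    have hδb : d + b = δ • (∑ l ∈ I, a l - c • a i) + (1 - j * δ) • b + (δ * c) • b := by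
      simp only [d, hsub]
      module
    rw [hδb, hδj]
    module
  have hdK : d + b ∈ PSDTuple j m := by
    intro t
    rw [hdb]
    have := ((hc t).smul hδ0.le).add ((hb t).smul (mul_pos hδ0 hc0).le)
    simpa [Finset.sum_apply] using this
  have hpd : (p (d + b)).PosSemidef := by
    have : p (d + b) ∈ PSDCone k := hp ▸ ⟨_, ⟨hdK, hdH⟩, rfl⟩
    exact this
  obtain ⟨w, hw⟩ := exists_dotProduct_momentCurve (k := k) I (hI ▸ hjk)
  have hnonneg := hpd.dotProduct_mulVec_nonneg w
  have hz : ∑ l ∈ I, (w ⬝ᵥ v l) ^ 2 = 0 :=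
    Finset.sum_eq_zero fun l hl => by rw [(hw l).mpr hl, sq, mul_zero]
  have hval : star w ⬝ᵥ (p (d + b)).mulVec w = -(δ * c * (w ⬝ᵥ v i) ^ 2) := by
    simp only [hdb, map_add, map_sub, map_smul, map_sum, hpb, hpa, smul_zero, add_zero, zero_add,
      star_trivial, Matrix.smul_mulVec, Matrix.sub_mulVec, Matrix.sum_mulVec, dotProduct_smul,
      dotProduct_sub, dotProduct_sum, dotProduct_vecMulVec_mulVec_self, hz, smul_eq_mul]
    ring
  have hpos : 0 < (w ⬝ᵥ v i) ^ 2 := by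
    have : w ⬝ᵥ v i ≠ 0 := fun h => hiI ((hw i).mp h)
    positivity
  have : 0 < δ * c * (w ⬝ᵥ v i) ^ 2 := by positivity
  rw [hval] at hnonneg
  linarith

theorem hasLift_psdTuple_one_psdCone (k : ℕ) : HasLift (PSDTuple k 1) (PSDCone k) := by
  refine ⟨⊤, LinearMap.proj 0, ?_⟩
  ext A
  constructor
  · intro hA
    exact ⟨fun _ => A, ⟨fun _ => hA, trivial⟩, rfl⟩
  · rintro ⟨B, ⟨hB, -⟩, rfl⟩
    exact hB 0

theorem sxdeg_psdCone (k : ℕ) : sxdeg (PSDCone k) = (k : ℕ∞) := by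
  refine le_antisymm (sInf_le ⟨k, 1, rfl, hasLift_psdTuple_one_psdCone k⟩) (le_sInf ?_)
  rintro _ ⟨j, m, rfl, h⟩
  by_contra! hlt
  exact not_hasLift_psdTuple_psdCone m (by exact_mod_cast hlt) h

/-- Corollary 2.5: `sxdeg(𝒮₊ᵏ) = k`; `𝒮₊ᵏ` has no `(𝒮₊ʲ)^m`-lift for `j < k` and any `m`,
while it trivially has an `𝒮₊ᵏ`-lift. -/
theorem stmt_4 (k : ℕ) (hk : 1 ≤ k) :
    sxdeg (PSDCone k) = (k : ℕ∞) ∧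
    (∀ j m : ℕ, j < k → ¬ HasLift (PSDTuple j m) (PSDCone k)) ∧
    HasLift (PSDCone k) (PSDCone k) := by
  refine ⟨sxdeg_psdCone k, fun _ m hj => not_hasLift_psdTuple_psdCone m hj,
    ⊤, LinearMap.id, ?_⟩
  simp
end
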